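/- arXiv:1303.7381 — 5 statements merged into one kernel-verified Lean document; each statement's English description precedes it below -/
import Mathlib

section
/- (Fell-type absorption.) Let (ρ, v) be an equivariant representation of Σ on a Hilbert A-module X. Then the product covariant representation (ρ ⊗̇ ℓ_Σ, v ⊗̇ λ_Σ) of Σ on X ⊗_{ℓ_Σ} A^Σ is unitarily equivalent to the regular covariant representation (ρ̃, λ̃_ρ) of Σ on X^G: concretely, the unitary W ∈ L(X ⊗_{ℓ_Σ} A^Σ, X^G) with [W(x ⊗̇ ξ)](g) = v(g)^{-1}(x · ξ(g)) satisfies W(ρ ⊗̇ ℓ_Σ)(a)W* = ρ̃(a) and W(v ⊗̇ λ_Σ)(g)W* = λ̃_ρ(g) for all a ∈ A, g ∈ G. -/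
open scoped ComplexOrder

noncomputable section

namespace BCFourier

/-- A twisted (unital, discrete) C*-dynamical system `Σ = (A, G, α, σ)`. -/
structure TwistedSystem (A : Type*) (G : Type*) [CStarAlgebra A] [Group G] where
  α : G → (A ≃⋆ₐ[ℂ] A)
  σ : G → G → A
  σ_unitary : ∀ g h, σ g h ∈ unitary A
  alpha_mul : ∀ g h a, α g (α h a) = σ g h * α (g * h) a * star (σ g h)
  sigma_cocycle : ∀ g h k, σ g h * σ (g * h) k = α g (σ h k) * σ g (h * k)
  sigma_one_left : ∀ g, σ 1 g = 1
  sigma_one_right : ∀ g, σ g 1 = 1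

variable {A G B : Type*} [CStarAlgebra A] [Group G] [CStarAlgebra B]

/-- Membership in the Hilbert `A`-module `A^Σ`:  unconditional norm convergence of
`∑_g α_g⁻¹(ξ(g)* ξ(g))`. -/
def MemAS (S : TwistedSystem A G) (ξ : G → A) : Prop :=
  Summable fun g => (S.α g).symm (star (ξ g) * ξ g)

/-- The `A`-valued inner product `⟨ξ, η⟩_α = ∑_g α_g⁻¹(ξ(g)* η(g))` on `A^Σ`. -/
def innerAS (S : TwistedSystem A G) (ξ η : G → A) : A :=
  ∑' g, (S.α g).symm (star (ξ g) * η g)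

/-- The norm `‖ξ‖_α = ‖⟨ξ,ξ⟩_α‖^{1/2}` on `A^Σ`. -/
def normAS (S : TwistedSystem A G) (ξ : G → A) : ℝ :=
  Real.sqrt ‖innerAS S ξ ξ‖

/-- Abstract characterization of the reduced twisted crossed product `C*_r(Σ)`:
a C*-algebra `B` together with a copy `ι` of `A`, unitaries `u g` implementing the
twisted action, and the canonical faithful conditional expectation `E`, such that
the Fourier coefficients `x̂(g) = E(x u_g*)` lie in `A^Σ`, `E(x* x) = ⟨x̂, x̂⟩_α`,
and `B` is topologically generated by the elements `ι(a) u g`. -/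
structure CrossedProduct {A G : Type*} [CStarAlgebra A] [Group G]
    (S : TwistedSystem A G) (B : Type*) [CStarAlgebra B] where
  ι : A →⋆ₐ[ℂ] B
  ι_isometric : ∀ a, ‖ι a‖ = ‖a‖
  u : G → B
  u_unitary : ∀ g, u g ∈ unitary B
  u_one : u 1 = 1
  covariance : ∀ g a, u g * ι a = ι (S.α g a) * u g
  u_mul : ∀ g h, u g * u h = ι (S.σ g h) * u (g * h)
  E : B →L[ℂ] A
  E_iota : ∀ a, E (ι a) = a
  E_perp : ∀ a g, g ≠ 1 → E (ι a * u g) = 0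
  E_contractive : ∀ x, ‖E x‖ ≤ ‖x‖
  E_faithful : ∀ x, E (star x * x) = 0 → x = 0
  hat_mem : ∀ x : B, MemAS S fun g => E (x * star (u g))
  E_inner : ∀ x : B,
    E (star x * x) = innerAS S (fun g => E (x * star (u g))) fun g => E (x * star (u g))
  generated : Dense (↑(Submodule.span ℂ {b : B | ∃ a g, b = ι a * u g}) : Set B)

variable {S : TwistedSystem A G}

/-- The Fourier transform `x̂ : G → A` of `x ∈ C*_r(Σ)`. -/
def hatF (D : CrossedProduct S B) (x : B) : G → A := fun g => D.E (x * star (D.u g))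

/-- The norm `‖x‖_α = ‖x̂‖_α = ‖E(x* x)‖^{1/2}` on `C*_r(Σ)`. -/
def alphaNorm (D : CrossedProduct S B) (x : B) : ℝ := Real.sqrt ‖D.E (star x * x)‖

/-- `Λ_Σ(f) = ∑_g f(g) λ_Σ(g)` for finitely supported `f : G → A`. -/
def Lam (D : CrossedProduct S B) (f : G → A) : B := ∑ᶠ g, D.ι (f g) * D.u g

/-- `CF(Σ)`: the set of `x ∈ C*_r(Σ)` whose Fourier series `∑_g x̂(g) λ_Σ(g)`
converges unconditionally in the operator norm. -/
def CFmem (D : CrossedProduct S B) (x : B) : Prop :=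
  ∃ y : B, HasSum (fun g => D.ι (hatF D x g) * D.u g) y

/-- `M : C*_r(Σ) → C*_r(Σ)` is the bounded map associated with the (reduced)
multiplier `T : G × A → A`, i.e. `T ∈ MA(Σ)` with `M_T = M`. -/
def IsMultiplier (D : CrossedProduct S B) (T : G → A → A) (M : B →L[ℂ] B) : Prop :=
  (∀ g, IsLinearMap ℂ (T g)) ∧ ∀ g a, M (D.ι a * D.u g) = D.ι (T g a) * D.u g

/-- The norm of a column vector in the Hilbert `B`-module `Bⁿ`. -/
def vecNorm {n : ℕ} (x : Fin n → B) : ℝ := Real.sqrt ‖∑ i, star (x i) * x i‖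

/-- The C*-norm on `Mₙ(B)`, realized as the operator norm for the action of
matrices on the Hilbert `B`-module `Bⁿ`. -/
def matNorm {n : ℕ} (m : Matrix (Fin n) (Fin n) B) : ℝ :=
  sInf {M : ℝ | 0 ≤ M ∧ ∀ x : Fin n → B, vecNorm (m.mulVec x) ≤ M * vecNorm x}

/-- `φ : B → B` is completely bounded with cb-norm at most `M`. -/
def CBBoundedBy (φ : B → B) (M : ℝ) : Prop :=
  0 ≤ M ∧ ∀ (n : ℕ) (m : Matrix (Fin n) (Fin n) B), matNorm (m.map φ) ≤ M * matNorm m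

/-- The completely bounded norm `‖φ‖_cb`. -/
def cbNorm (φ : B → B) : ℝ := sInf {M : ℝ | CBBoundedBy φ M}

/-- `φ : B → B` is completely bounded. -/
def IsCompletelyBounded (φ : B → B) : Prop := ∃ M, CBBoundedBy φ M

/-- `φ : B → B` is completely positive. -/
def IsCompletelyPositive [PartialOrder B] [StarOrderedRing B] (φ : B → B) : Prop :=
  ∀ (n : ℕ) (b c : Fin n → B), 0 ≤ ∑ i, ∑ j, star (c i) * φ (star (b i) * b j) * c j

/-- `ξ` tends to `0` at infinity w.r.t. the norm `N`. -/
def TendsZeroAtInfty (N : (G → A) → ℝ) (ξ : G → A) : Prop :=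
  ∀ ε : ℝ, 0 < ε → ∃ F₀ : Finset G, ∀ F : Finset G, Disjoint F F₀ →
    N (Set.indicator (↑F : Set G) ξ) < ε

/-- The (closed, two-sided) ideal of `C*_r(Σ)` induced by a subset `J` of `A`. -/
def genIdeal (D : CrossedProduct S B) (J : Set A) : Set B :=
  closure ↑(Submodule.span ℂ {z : B | ∃ x y : B, ∃ j ∈ J, z = x * D.ι j * y})

/-- `J` is an `α`-invariant closed two-sided ideal of `A`. -/
def IsInvIdeal (S : TwistedSystem A G) (J : Set A) : Prop :=
  IsClosed J ∧ (0 : A) ∈ J ∧ (∀ a b, a ∈ J → b ∈ J → a + b ∈ J) ∧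
    (∀ a ∈ J, ∀ b : A, b * a ∈ J ∧ a * b ∈ J) ∧ ∀ g, ∀ a ∈ J, S.α g a ∈ J

/-- A closed two-sided ideal of a C*-algebra, as a set. -/
def IsClosedIdeal {B : Type*} [CStarAlgebra B] (I : Set B) : Prop :=
  IsClosed I ∧ (0 : B) ∈ I ∧ (∀ x y, x ∈ I → y ∈ I → x + y ∈ I) ∧
    ∀ x ∈ I, ∀ b : B, b * x ∈ I ∧ x * b ∈ I

/-- An ideal `I` of `C*_r(Σ)` is `E`-invariant when `E(I) ⊆ I`. -/
def EInv (D : CrossedProduct S B) (I : Set B) : Prop := ∀ x ∈ I, D.ι (D.E x) ∈ I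

/-- A Fourier summing net for `Σ`: a net `{Tⁱ}` in `MCF(Σ)` such that
`M_{Tⁱ}(x) → x` in norm for every `x ∈ C*_r(Σ)`. -/
structure FSNet {A G : Type*} [CStarAlgebra A] [Group G] {S : TwistedSystem A G}
    {B : Type*} [CStarAlgebra B] (D : CrossedProduct S B) where
  Idx : Type
  pre : Preorder Idx
  dir : IsDirected Idx fun a b => pre.le a b
  nonempty : Nonempty Idx
  T : Idx → G → A → A
  T_lin : ∀ i g, IsLinearMap ℂ (T i g)
  M : Idx → B →L[ℂ] B
  M_mult : ∀ i g a, M i (D.ι a * D.u g) = D.ι (T i g a) * D.u g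
  M_cf : ∀ i x, CFmem D (M i x)
  M_lim : ∀ x : B, Filter.Tendsto (fun i => ‖M i x - x‖) (@Filter.atTop Idx pre) (nhds 0)

/-- `Σ` has the bounded Fejér property: there is a bounded Fourier summing net for `Σ`
consisting of multipliers with finite `G`-support. -/
def HasBoundedFejer (D : CrossedProduct S B) : Prop :=
  ∃ net : FSNet D, (∃ C : ℝ, ∀ i, ‖net.M i‖ ≤ C) ∧ ∀ i, {g | ∃ a, net.T i g a ≠ 0}.Finite


/-- A (right) Hilbert `A`-module structure on `X`: right `A`-action `smulA`,
`A`-valued inner product (linear in the second variable), with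
`‖x‖ = ‖⟨x,x⟩‖^{1/2}`. -/
structure HilbMod (A : Type*) [CStarAlgebra A] [PartialOrder A] [StarOrderedRing A]
    (X : Type*) [NormedAddCommGroup X] [NormedSpace ℂ X] where
  smulA : X → A → X
  inner : X → X → A
  smulA_add : ∀ x a b, smulA x (a + b) = smulA x a + smulA x b
  add_smulA : ∀ x y a, smulA (x + y) a = smulA x a + smulA y a
  smulA_mul : ∀ x a b, smulA x (a * b) = smulA (smulA x a) b
  smulA_one : ∀ x, smulA x 1 = x
  smulA_smul : ∀ (c : ℂ) x a, smulA (c • x) a = c • smulA x a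
  smul_smulA : ∀ (c : ℂ) x a, smulA x (c • a) = c • smulA x a
  inner_add_right : ∀ x y z, inner x (y + z) = inner x y + inner x z
  inner_smulA_right : ∀ x y a, inner x (smulA y a) = inner x y * a
  inner_smul_right : ∀ (c : ℂ) x y, inner x (c • y) = c • inner x y
  inner_conj : ∀ x y, star (inner x y) = inner y x
  inner_self_nonneg : ∀ x, 0 ≤ inner x x
  inner_self_eq_zero : ∀ x, inner x x = 0 → x = 0
  norm_eq : ∀ x, ‖x‖ = Real.sqrt ‖inner x x‖

/-- `π` is a representation of `A` by adjointable operators on the Hilbert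
`A`-module `X`. -/
def IsRepOn {A X : Type*} [CStarAlgebra A] [PartialOrder A] [StarOrderedRing A]
    [NormedAddCommGroup X] [NormedSpace ℂ X] (hX : HilbMod A X) (π : A → X →L[ℂ] X) : Prop :=
  π 1 = ContinuousLinearMap.id ℂ X ∧
  (∀ a b x, π (a * b) x = π a (π b x)) ∧
  (∀ a b, π (a + b) = π a + π b) ∧
  (∀ (c : ℂ) a, π (c • a) = c • π a) ∧
  (∀ a x y, hX.inner (π a x) y = hX.inner x (π (star a) y)) ∧
  ∀ a x b, π a (hX.smulA x b) = hX.smulA (π a x) b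

/-- An equivariant representation `(ρ, v)` of `Σ` on a Hilbert `A`-module `X`. -/
structure EquivRep {A G : Type*} [CStarAlgebra A] [PartialOrder A] [StarOrderedRing A]
    [Group G] (S : TwistedSystem A G) {X : Type*} [NormedAddCommGroup X] [NormedSpace ℂ X]
    (hX : HilbMod A X) where
  ρ : A → X →L[ℂ] X
  ρ_rep : IsRepOn hX ρ
  v : G → X ≃L[ℂ] X
  cov : ∀ g a x, ρ (S.α g a) x = v g (ρ a ((v g).symm x))
  v_mul : ∀ g h x, v g (v h x) = hX.smulA (ρ (S.σ g h) (v (g * h) x)) (star (S.σ g h))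
  v_inner : ∀ g x y, S.α g (hX.inner x y) = hX.inner (v g x) (v g y)
  v_smulA : ∀ g x a, v g (hX.smulA x a) = hX.smulA (v g x) (S.α g a)

/-- The data of the quotient system `Σ̃ = (A/J, G, α̃, σ̃)`, its reduced crossed
product, and the canonical map `q̃ : C*_r(Σ) → C*_r(Σ̃)`. -/
structure QuotientData {A G : Type*} [CStarAlgebra A] [Group G] {S : TwistedSystem A G}
    {B : Type*} [CStarAlgebra B] (D : CrossedProduct S B) (J : Set A) where
  Aq : Type
  [algAq : CStarAlgebra Aq]
  Sq : @TwistedSystem Aq G algAq _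
  Bq : Type
  [algBq : CStarAlgebra Bq]
  Dq : @CrossedProduct Aq G algAq _ Sq Bq algBq
  q : A → Aq
  q_add : ∀ a b, q (a + b) = q a + q b
  q_mul : ∀ a b, q (a * b) = q a * q b
  q_star : ∀ a, q (star a) = star (q a)
  q_smul : ∀ (c : ℂ) a, q (c • a) = c • q a
  q_one : q 1 = 1
  q_surj : Function.Surjective q
  q_ker : ∀ a, q a = 0 ↔ a ∈ J
  q_alpha : ∀ g a, q (S.α g a) = Sq.α g (q a)
  q_sigma : ∀ g h, q (S.σ g h) = Sq.σ g h
  Q : B → Bq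
  Q_add : ∀ x y, Q (x + y) = Q x + Q y
  Q_smul : ∀ (c : ℂ) x, Q (c • x) = c • Q x
  Q_mul : ∀ x y, Q (x * y) = Q x * Q y
  Q_star : ∀ x, Q (star x) = star (Q x)
  Q_cont : Continuous Q
  Q_gen : ∀ a g, Q (D.ι a * D.u g) = Dq.ι (q a) * Dq.u g

attribute [instance] QuotientData.algAq QuotientData.algBq

/-- The data of the reduced group C*-algebra `C*_r(G)`, the minimal tensor
product `C*_r(Σ) ⊗ C*_r(G)` and the reduced dual coaction
`δ_Σ : C*_r(Σ) → C*_r(Σ) ⊗ C*_r(G)`, `δ_Σ(a λ_Σ(g)) = a λ_Σ(g) ⊗ λ(g)`,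
together with the slice map `id ⊗ τ` satisfying `(id ⊗ τ) ∘ δ_Σ = E`. -/
structure CoactionData {A G : Type*} [CStarAlgebra A] [Group G] {S : TwistedSystem A G}
    {B : Type*} [CStarAlgebra B] (D : CrossedProduct S B) where
  CG : Type
  [algCG : CStarAlgebra CG]
  lam : G → CG
  lam_unitary : ∀ g, lam g ∈ unitary CG
  lam_mul : ∀ g h, lam (g * h) = lam g * lam h
  lam_gen : Dense (↑(Submodule.span ℂ (Set.range lam)) : Set CG)
  tau : CG →L[ℂ] ℂ
  tau_pos : ∀ c, 0 ≤ tau (star c * c)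
  tau_lam_one : tau (lam 1) = 1
  tau_lam_ne : ∀ g, g ≠ 1 → tau (lam g) = 0
  BT : Type
  [algBT : CStarAlgebra BT]
  tens : B → CG → BT
  tens_add_left : ∀ x y c, tens (x + y) c = tens x c + tens y c
  tens_add_right : ∀ x c d, tens x (c + d) = tens x c + tens x d
  tens_smul_left : ∀ (z : ℂ) x c, tens (z • x) c = z • tens x c
  tens_smul_right : ∀ (z : ℂ) x c, tens x (z • c) = z • tens x c
  tens_mul : ∀ x y c d, tens x c * tens y d = tens (x * y) (c * d)
  tens_star : ∀ x c, star (tens x c) = tens (star x) (star c)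
  tens_norm : ∀ x c, ‖tens x c‖ = ‖x‖ * ‖c‖
  tens_gen : Dense (↑(Submodule.span ℂ {z : BT | ∃ x c, z = tens x c}) : Set BT)
  slice : BT →L[ℂ] B
  slice_tens : ∀ x c, slice (tens x c) = tau c • x
  delta : B → BT
  delta_add : ∀ x y, delta (x + y) = delta x + delta y
  delta_smul : ∀ (z : ℂ) x, delta (z • x) = z • delta x
  delta_mul : ∀ x y, delta (x * y) = delta x * delta y
  delta_star : ∀ x, delta (star x) = star (delta x)
  delta_cont : Continuous delta
  delta_gen : ∀ a g, delta (D.ι a * D.u g) = tens (D.ι a * D.u g) (lam g)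
  slice_delta : ∀ x, slice (delta x) = D.ι (D.E x)

attribute [instance] CoactionData.algCG CoactionData.algBT


namespace HilbMod

variable {A : Type*} [CStarAlgebra A] [PartialOrder A] [StarOrderedRing A]
variable {X : Type*} [NormedAddCommGroup X] [NormedSpace ℂ X] (hX : HilbMod A X)

include hX

/-- The inner product as an additive homomorphism in its second variable. -/
def innerAddHom (x : X) : X →+ A := AddMonoidHom.mk' (hX.inner x) (hX.inner_add_right x)

lemma inner_zero_right (x : X) : hX.inner x 0 = 0 := (hX.innerAddHom x).map_zero

lemma inner_sub_right (x y z : X) : hX.inner x (y - z) = hX.inner x y - hX.inner x z :=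
  (hX.innerAddHom x).map_sub y z

lemma inner_sum_right {ι : Type*} (x : X) (F : Finset ι) (f : ι → X) :
    hX.inner x (∑ i ∈ F, f i) = ∑ i ∈ F, hX.inner x (f i) :=
  map_sum (hX.innerAddHom x) f F

lemma inner_sub_left (x y z : X) : hX.inner (x - y) z = hX.inner x z - hX.inner y z := by
  rw [← hX.inner_conj, inner_sub_right, star_sub, hX.inner_conj, hX.inner_conj]

lemma inner_sum_left {ι : Type*} (F : Finset ι) (f : ι → X) (y : X) :
    hX.inner (∑ i ∈ F, f i) y = ∑ i ∈ F, hX.inner (f i) y := by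
  rw [← hX.inner_conj, inner_sum_right, star_sum]
  simp only [hX.inner_conj]

lemma inner_smul_left (c : ℂ) (x y : X) : hX.inner (c • x) y = star c • hX.inner x y := by
  rw [← hX.inner_conj, hX.inner_smul_right, star_smul, hX.inner_conj]

lemma inner_smulA_left (x y : X) (a : A) :
    hX.inner (hX.smulA x a) y = star a * hX.inner x y := by
  rw [← hX.inner_conj, hX.inner_smulA_right, star_mul, hX.inner_conj]

lemma norm_sq (x : X) : ‖x‖ ^ 2 = ‖hX.inner x x‖ := by
  rw [hX.norm_eq, Real.sq_sqrt (norm_nonneg _)]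

lemma ext_inner {z w : X} (h : ∀ y, hX.inner y z = hX.inner y w) : z = w := by
  rw [← sub_eq_zero]
  apply hX.inner_self_eq_zero
  rw [inner_sub_right, h, sub_self]

lemma conj_inner_self_le (x : X) (a : A) :
    star a * hX.inner x x * a ≤ ‖x‖ ^ 2 • (star a * a) := by
  rw [hX.norm_sq]
  exact CStarAlgebra.star_left_conjugate_le_norm_smul (hX.inner_conj x x)

/-- The Cauchy-Schwarz inequality. -/
lemma norm_inner_le (x y : X) : ‖hX.inner x y‖ ≤ ‖x‖ * ‖y‖ := by
  rcases eq_or_ne x 0 with rfl | hx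
  · rw [← hX.inner_conj, inner_zero_right]
    simp
  have hr : 0 < ‖x‖ ^ 2 := by positivity
  set r : ℝ := ‖x‖ ^ 2 with hrdef
  set a := hX.inner x y with ha
  have hyx : hX.inner y x = star a := by rw [ha, hX.inner_conj]
  have key : star a * a ≤ r • hX.inner y y := by
    have h0 := hX.inner_self_nonneg (hX.smulA x a - (r : ℂ) • y)
    have h1 : hX.inner (hX.smulA x a - (r : ℂ) • y) (hX.smulA x a - (r : ℂ) • y)
        = star a * hX.inner x x * a - r • (star a * a) - r • (star a * a)
          + r • (r • hX.inner y y) := by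
      simp only [inner_sub_right, inner_sub_left, hX.inner_smul_right, inner_smul_left,
        hX.inner_smulA_right, inner_smulA_left, hyx, ← ha, Complex.star_def,
        Complex.conj_ofReal, sub_mul, smul_mul_assoc]
      simp only [Complex.coe_smul, smul_sub]
      abel
    rw [h1] at h0
    have h2 := hX.conj_inner_self_le x a
    rw [← hrdef] at h2
    have h3 : r • (star a * a) ≤ r • (r • hX.inner y y) := by
      rw [← sub_nonneg] at h2 ⊢
      refine (add_nonneg h0 h2).trans_eq ?_
      abel
    exact (smul_le_smul_iff_of_pos_left hr).mp h3
  have h := CStarAlgebra.norm_le_norm_of_nonneg_of_le (star_mul_self_nonneg a) key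
  rw [CStarRing.norm_star_mul_self, norm_smul, ← hX.norm_sq, Real.norm_of_nonneg hr.le, hrdef,
    ← mul_pow, ← pow_two] at h
  exact (pow_le_pow_iff_left₀ (norm_nonneg _) (by positivity) two_ne_zero).mp h

/-- The inner product as a continuous linear map in its second variable. -/
def innerCLM (x : X) : X →L[ℂ] A :=
  LinearMap.mkContinuous
    { toFun := hX.inner x
      map_add' := hX.inner_add_right x
      map_smul' := fun c => hX.inner_smul_right c x } ‖x‖ (hX.norm_inner_le x)

lemma innerCLM_apply (x y : X) : hX.innerCLM x y = hX.inner x y := rfl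

variable {T : Type*} [NormedAddCommGroup T] [NormedSpace ℂ T] (hT : HilbMod A T)

/-- A linear map preserving inner products is isometric. -/
lemma norm_map (J : X →ₗ[ℂ] T) (hJ : ∀ x, hT.inner (J x) (J x) = hX.inner x x) (x : X) :
    ‖J x‖ = ‖x‖ := by
  rw [hT.norm_eq, hJ, ← hX.norm_eq]

/-- An inner product preserving linear map which has an adjoint on a total subset has
an adjoint everywhere. -/
lemma exists_adjoint [CompleteSpace X] (J : X →ₗ[ℂ] T)
    (hJ : ∀ x y, hT.inner (J x) (J y) = hX.inner x y) (s : Set T)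
    (hs : Dense (↑(Submodule.span ℂ s) : Set T))
    (hadj : ∀ t ∈ s, ∃ z, ∀ y, hT.inner (J y) t = hX.inner y z) :
    ∃ L : T →L[ℂ] X, ∀ y t, hT.inner (J y) t = hX.inner y (L t) := by
  have hnorm := hX.norm_map hT J fun x => hJ x x
  have bound : ∀ t z, (∀ y, hT.inner (J y) t = hX.inner y z) → ‖z‖ ≤ ‖t‖ := by
    intro t z h
    have h1 := hT.norm_inner_le (J z) t
    rw [h, ← hX.norm_sq, hnorm, pow_two] at h1
    rcases eq_or_ne z 0 with rfl | hz
    · simp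
    · exact le_of_mul_le_mul_left h1 (norm_pos_iff.mpr hz)
  let M : Submodule ℂ T :=
    { carrier := {t | ∃ z, ∀ y, hT.inner (J y) t = hX.inner y z}
      zero_mem' := ⟨0, fun y => by rw [inner_zero_right, inner_zero_right]⟩
      add_mem' := by
        rintro t t' ⟨z, hz⟩ ⟨z', hz'⟩
        exact ⟨z + z', fun y => by rw [hT.inner_add_right, hX.inner_add_right, hz, hz']⟩
      smul_mem' := by
        rintro c t ⟨z, hz⟩
        exact ⟨c • z, fun y => by rw [hT.inner_smul_right, hX.inner_smul_right, hz]⟩ }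
  have hclosed : IsClosed (M : Set T) := by
    refine IsSeqClosed.isClosed fun t l ht hl => ?_
    choose z hz using ht
    have hc : CauchySeq z := by
      have ht' := hl.cauchySeq
      rw [Metric.cauchySeq_iff] at ht' ⊢
      intro ε hε
      obtain ⟨N, hN⟩ := ht' ε hε
      refine ⟨N, fun m hm n hn => lt_of_le_of_lt ?_ (hN m hm n hn)⟩
      rw [dist_eq_norm, dist_eq_norm]
      exact bound _ _ fun y => by rw [inner_sub_right, inner_sub_right, hz, hz]
    obtain ⟨w, hw⟩ := cauchySeq_tendsto_of_complete hc
    refine ⟨w, fun y => ?_⟩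
    have h1 := ((hT.innerCLM (J y)).continuous.tendsto l).comp hl
    have h2 := ((hX.innerCLM y).continuous.tendsto w).comp hw
    exact tendsto_nhds_unique h1 (h2.congr fun n => (hz n y).symm)
  have hall : ∀ t, ∃ z, ∀ y, hT.inner (J y) t = hX.inner y z := fun t =>
    closure_minimal (Submodule.span_le.mpr hadj : Submodule.span ℂ s ≤ M) hclosed (hs t)
  choose L hL using hall
  refine ⟨LinearMap.mkContinuous
    { toFun := L
      map_add' := fun t t' => hX.ext_inner fun y => by
        rw [hX.inner_add_right, ← hL, ← hL, ← hL, hT.inner_add_right]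
      map_smul' := fun c t => hX.ext_inner fun y => by
        rw [RingHom.id_apply, hX.inner_smul_right, ← hL, ← hL, hT.inner_smul_right] } 1
    (fun t => by simpa using bound t (L t) (hL t)), fun y t => hL t y⟩

lemma hasSum_inner {G : Type*} (J : G → X →ₗ[ℂ] T) (L : G → T →L[ℂ] X)
    (hL : ∀ g y t, hT.inner (J g y) t = hX.inner y (L g t)) {t' : T} (ht : HasSum (fun g => J g (L g t')) t') (t : T) :
    HasSum (fun g => hX.inner (L g t) (L g t')) (hT.inner t t') := by
  have h := ht.mapL (hT.innerCLM t)
  simp only [innerCLM_apply] at h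
  refine h.congr_fun fun g => ?_
  rw [← hT.inner_conj, hL, hX.inner_conj]

section OrthogonalFamily

variable {G : Type*} (J : G → X →ₗ[ℂ] T)
  (hJ : ∀ g x y, hT.inner (J g x) (J g y) = hX.inner x y)
  (hJ' : ∀ g h x y, g ≠ h → hT.inner (J g x) (J h y) = 0)

include hJ hJ'

lemma inner_sum_sum (F : Finset G) (ζ : G → X) :
    hT.inner (∑ g ∈ F, J g (ζ g)) (∑ g ∈ F, J g (ζ g)) = ∑ g ∈ F, hX.inner (ζ g) (ζ g) := by
  rw [inner_sum_left]
  refine Finset.sum_congr rfl fun g hg => ?_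
  rw [inner_sum_right, Finset.sum_eq_single g, hJ]
  · exact fun h _ hne => hJ' g h _ _ hne.symm
  · exact fun h => absurd hg h

lemma summable_of_summable_inner [CompleteSpace T] (ζ : G → X)
    (hζ : Summable fun g => hX.inner (ζ g) (ζ g)) : Summable fun g => J g (ζ g) := by
  rw [summable_iff_vanishing_norm] at hζ ⊢
  intro ε hε
  obtain ⟨s, hs⟩ := hζ (ε ^ 2) (by positivity)
  refine ⟨s, fun F hF => ?_⟩
  have h := hs F hF
  rw [← inner_sum_sum hX hT J hJ hJ' F ζ, ← hT.norm_sq] at h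
  exact lt_of_pow_lt_pow_left₀ 2 hε.le h

variable (L : G → T →L[ℂ] X) (hL : ∀ g y t, hT.inner (J g y) t = hX.inner y (L g t))

include hL

lemma inner_sub_sum (F : Finset G) (t : T) :
    hT.inner (t - ∑ g ∈ F, J g (L g t)) (t - ∑ g ∈ F, J g (L g t))
      = hT.inner t t - ∑ g ∈ F, hX.inner (L g t) (L g t) := by
  have h1 : hT.inner (∑ g ∈ F, J g (L g t)) t = ∑ g ∈ F, hX.inner (L g t) (L g t) := by
    simp only [inner_sum_left, hL]
  have h2 : hT.inner t (∑ g ∈ F, J g (L g t)) = ∑ g ∈ F, hX.inner (L g t) (L g t) := by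
    rw [← hT.inner_conj, h1, star_sum]
    simp only [hX.inner_conj]
  rw [inner_sub_left, inner_sub_right, inner_sub_right, h1, h2,
    inner_sum_sum hX hT J hJ hJ' F fun g => L g t]
  abel

lemma norm_sub_sum_le (F : Finset G) (t : T) : ‖t - ∑ g ∈ F, J g (L g t)‖ ≤ ‖t‖ := by
  rw [hT.norm_eq, hT.norm_eq t]
  refine Real.sqrt_le_sqrt
    (CStarAlgebra.norm_le_norm_of_nonneg_of_le (hT.inner_self_nonneg _) ?_)
  rw [inner_sub_sum hX hT J hJ hJ' L hL, sub_le_self_iff]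
  exact Finset.sum_nonneg fun g _ => hX.inner_self_nonneg _

lemma hasSum_of_hasSum_inner {t : T}
    (ht : HasSum (fun g => hX.inner (L g t) (L g t)) (hT.inner t t)) :
    HasSum (fun g => J g (L g t)) t := by
  rw [HasSum, SummationFilter.unconditional_filter] at ht ⊢
  rw [tendsto_iff_norm_sub_tendsto_zero] at ht ⊢
  have h := (Real.continuous_sqrt.tendsto _).comp ht
  rw [Real.sqrt_zero] at h
  refine h.congr fun F => ?_
  rw [norm_sub_rev, hT.norm_eq, inner_sub_sum hX hT J hJ hJ' L hL, Function.comp_apply,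
    norm_sub_rev]

/-- Parseval's identity on a total subset yields the Fourier expansion of every vector. -/
lemma hasSum_of_dense (s : Set T) (hs : Dense (↑(Submodule.span ℂ s) : Set T))
    (hsum : ∀ t ∈ s, HasSum (fun g => hX.inner (L g t) (L g t)) (hT.inner t t)) (t : T) :
    HasSum (fun g => J g (L g t)) t := by
  classical
  have hspan : ∀ t ∈ Submodule.span ℂ s, HasSum (fun g => J g (L g t)) t := by
    intro t ht
    induction ht using Submodule.span_induction with
    | mem t ht => exact hasSum_of_hasSum_inner hX hT J hJ hJ' L hL (hsum t ht)
    | zero => simp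
    | add t t' _ _ h h' => simpa using h.add h'
    | smul c t _ h => simpa using h.const_smul c
  rw [HasSum, SummationFilter.unconditional_filter, Metric.tendsto_atTop]
  intro ε hε
  obtain ⟨u, hu, htu⟩ := hs.exists_dist_lt t (half_pos hε)
  have hus := hspan u hu
  rw [HasSum, SummationFilter.unconditional_filter, Metric.tendsto_atTop] at hus
  obtain ⟨F₀, hF₀⟩ := hus (ε / 2) (half_pos hε)
  refine ⟨F₀, fun F hF => ?_⟩
  have h1 := hF₀ F hF
  have h2 := norm_sub_sum_le hX hT J hJ hJ' L hL F (t - u)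
  rw [dist_eq_norm] at htu
  rw [dist_comm, dist_eq_norm] at h1 ⊢
  have h3 : t - ∑ g ∈ F, J g (L g t)
      = (t - u - ∑ g ∈ F, J g (L g (t - u))) + (u - ∑ g ∈ F, J g (L g u)) := by
    simp only [map_sub, Finset.sum_sub_distrib]
    abel
  rw [h3]
  linarith [norm_add_le (t - u - ∑ g ∈ F, J g (L g (t - u))) (u - ∑ g ∈ F, J g (L g u))]

end OrthogonalFamily

end HilbMod

lemma memAS_single (S : TwistedSystem A G) [DecidableEq G] (g : G) (a : A) :
    MemAS S (Pi.single g a) := by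
  refine summable_of_ne_finset_zero (s := {g}) fun h hh => ?_
  rw [Pi.single_eq_of_ne (by simpa using hh)]
  simp

lemma TwistedSystem.symm_conj_sigma (S : TwistedSystem A G) (g k : G) (b : A) :
    (S.α (g * k)).symm (star (S.σ g k) * S.α g b * S.σ g k) = (S.α k).symm b := by
  rw [StarAlgEquiv.symm_apply_eq]
  have h := S.alpha_mul g k ((S.α k).symm b)
  rw [StarAlgEquiv.apply_symm_apply] at h
  have hu := Unitary.star_mul_self_of_mem (S.σ_unitary g k)
  calc star (S.σ g k) * S.α g b * S.σ g k
      = (star (S.σ g k) * S.σ g k) * S.α (g * k) ((S.α k).symm b)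
          * (star (S.σ g k) * S.σ g k) := by
        rw [h]
        simp only [mul_assoc]
    _ = _ := by rw [hu, one_mul, mul_one]

/-- `A^Σ` is invariant under `λ_Σ(g)`. -/
lemma MemAS.lambda {S : TwistedSystem A G} {ξ : G → A} (hξ : MemAS S ξ) (g : G) :
    MemAS S fun h => S.α g (ξ (g⁻¹ * h)) * S.σ g (g⁻¹ * h) := by
  refine ((Equiv.mulLeft g⁻¹).summable_iff.mpr hξ).congr fun h => ?_
  have h1 := S.symm_conj_sigma g (g⁻¹ * h) (star (ξ (g⁻¹ * h)) * ξ (g⁻¹ * h))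
  rw [mul_inv_cancel_left] at h1
  rw [Function.comp_apply, Equiv.coe_mulLeft, ← h1, star_mul, map_mul (S.α g), map_star (S.α g)]
  simp only [mul_assoc]

section EquivRep

variable [PartialOrder A] [StarOrderedRing A] {X : Type*} [NormedAddCommGroup X]
  [NormedSpace ℂ X] {hX : HilbMod A X}

lemma MemAS.summable_conj_inner {ξ : G → A} (hξ : MemAS S ξ) (hX : HilbMod A X) (x : X) :
    Summable fun g => (S.α g).symm (star (ξ g) * (hX.inner x x * ξ g)) := by
  have hpos : ∀ (g : G) (a : A), 0 ≤ a → 0 ≤ (S.α g).symm a := fun g a ha => map_nonneg _ ha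
  have hle : ∀ g, (S.α g).symm (star (ξ g) * (hX.inner x x * ξ g))
      ≤ ‖x‖ ^ 2 • (S.α g).symm (star (ξ g) * ξ g) := by
    intro g
    have h := hpos g _ (sub_nonneg.mpr (hX.conj_inner_self_le x (ξ g)))
    rw [← Complex.coe_smul, map_sub, map_smul, sub_nonneg, Complex.coe_smul, mul_assoc] at h
    exact h
  have hξ' : Summable fun g => ‖x‖ ^ 2 • (S.α g).symm (star (ξ g) * ξ g) :=
    Summable.const_smul _ hξ
  rw [summable_iff_vanishing_norm] at hξ' ⊢
  intro ε hε
  obtain ⟨s, hs⟩ := hξ' ε hε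
  refine ⟨s, fun F hF => lt_of_le_of_lt ?_ (hs F hF)⟩
  refine CStarAlgebra.norm_le_norm_of_nonneg_of_le (Finset.sum_nonneg fun g _ => ?_)
    (Finset.sum_le_sum fun g _ => hle g)
  refine hpos g _ ?_
  rw [← mul_assoc]
  exact star_left_conjugate_nonneg (hX.inner_self_nonneg x) _

namespace EquivRep

variable (er : EquivRep S hX)

include er

lemma inner_symm_right (g : G) (y z : X) :
    hX.inner y ((er.v g).symm z) = (S.α g).symm (hX.inner (er.v g y) z) := by
  rw [StarAlgEquiv.eq_symm_apply, er.v_inner, ContinuousLinearEquiv.apply_symm_apply]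

lemma inner_symm_symm (g : G) (y z : X) :
    hX.inner ((er.v g).symm y) ((er.v g).symm z) = (S.α g).symm (hX.inner y z) := by
  rw [inner_symm_right, ContinuousLinearEquiv.apply_symm_apply]

lemma symm_rho (g : G) (a : A) (x : X) :
    (er.v g).symm (er.ρ a x) = er.ρ ((S.α g).symm a) ((er.v g).symm x) := by
  rw [ContinuousLinearEquiv.symm_apply_eq, ← er.cov, StarAlgEquiv.apply_symm_apply]

lemma rho_smulA (a : A) (x : X) (b : A) :
    er.ρ a (hX.smulA x b) = hX.smulA (er.ρ a x) b := er.ρ_rep.2.2.2.2.2 a x b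

lemma symm_v_smulA_sigma (g k : G) (x : X) (a : A) :
    (er.v (g * k)).symm (hX.smulA (er.v g x) (S.α g a * S.σ g k))
      = er.ρ ((S.α (g * k)).symm (S.σ g k)) ((er.v k).symm (hX.smulA x a)) := by
  have h := er.v_mul g k ((er.v k).symm (hX.smulA x a))
  rw [ContinuousLinearEquiv.apply_symm_apply, er.v_smulA] at h
  rw [hX.smulA_mul, h, ← hX.smulA_mul, Unitary.star_mul_self_of_mem (S.σ_unitary g k),
    hX.smulA_one, er.symm_rho, ContinuousLinearEquiv.symm_apply_apply]

end EquivRep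

end EquivRep

/-- Theorem `fell`, Fell-type absorption. The unitary `W` of
Lemma `W` intertwines the product covariant representation
`(ρ ⊗̇ ℓ_Σ, v ⊗̇ λ_Σ)` of `Σ` on `X ⊗_{ℓ_Σ} A^Σ` with the regular covariant
representation `(ρ̃, λ̃_ρ)` on `X^G`. -/
theorem statement10 {A G : Type*} [CStarAlgebra A] [PartialOrder A] [StarOrderedRing A]
    [Group G] (S : TwistedSystem A G)
    {X : Type*} [NormedAddCommGroup X] [NormedSpace ℂ X] [CompleteSpace X]
    (hX : HilbMod A X) (er : EquivRep S hX)
    -- `T` is the internal tensor product Hilbert `A`-module `X ⊗_{ℓ_Σ} A^Σ`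
    {T : Type*} [NormedAddCommGroup T] [NormedSpace ℂ T] [CompleteSpace T]
    (hT : HilbMod A T) (tmul : X → (G → A) → T)
    (t_add_l : ∀ x x' ξ, MemAS S ξ → tmul (x + x') ξ = tmul x ξ + tmul x' ξ)
    (t_add_r : ∀ x ξ η, MemAS S ξ → MemAS S η → tmul x (ξ + η) = tmul x ξ + tmul x η)
    (t_smul : ∀ (c : ℂ) x ξ, MemAS S ξ → tmul (c • x) ξ = c • tmul x ξ)
    (t_balanced : ∀ x a ξ, MemAS S ξ → tmul (hX.smulA x a) ξ = tmul x fun g => a * ξ g)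
    (t_inner : ∀ x x' ξ ξ', MemAS S ξ → MemAS S ξ' →
        hT.inner (tmul x ξ) (tmul x' ξ')
          = ∑' g, (S.α g).symm (star (ξ g) * (hX.inner x x' * ξ' g)))
    (t_smulA : ∀ x ξ a, MemAS S ξ →
        hT.smulA (tmul x ξ) a = tmul x fun g => ξ g * S.α g a)
    (t_dense :
      Dense (↑(Submodule.span ℂ {t : T | ∃ x ξ, MemAS S ξ ∧ t = tmul x ξ}) : Set T))
    -- the product covariant representation `(ρ ⊗̇ ℓ_Σ, v ⊗̇ λ_Σ)` on `T`
    (P : A → T →L[ℂ] T)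
    (hP : ∀ a x ξ, MemAS S ξ → P a (tmul x ξ) = tmul (er.ρ a x) ξ)
    (Vop : G → T →L[ℂ] T)
    (hVop : ∀ g x ξ, MemAS S ξ → Vop g (tmul x ξ)
        = tmul (er.v g x) fun h => S.α g (ξ (g⁻¹ * h)) * S.σ g (g⁻¹ * h)) :
    ∃ W : T → G → X,
      (∀ t, Summable fun g => hX.inner (W t g) (W t g)) ∧
      (∀ ζ : G → X, (Summable fun g => hX.inner (ζ g) (ζ g)) → ∃ t, W t = ζ) ∧
      Function.Injective W ∧
      (∀ t t', W (t + t') = W t + W t') ∧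
      (∀ (c : ℂ) t, W (c • t) = c • W t) ∧
      (∀ t a, W (hT.smulA t a) = fun g => hX.smulA (W t g) a) ∧
      (∀ t t', hT.inner t t' = ∑' g, hX.inner (W t g) (W t' g)) ∧
      (∀ x ξ, MemAS S ξ → ∀ g, W (tmul x ξ) g = (er.v g).symm (hX.smulA x (ξ g))) ∧
      -- `W (ρ ⊗̇ ℓ_Σ)(a) W* = ρ̃(a)`
      (∀ a t g, W (P a t) g = er.ρ ((S.α g).symm a) (W t g)) ∧
      -- `W (v ⊗̇ λ_Σ)(g) W* = λ̃_ρ(g)`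
      ∀ g t h, W (Vop g t) h = er.ρ ((S.α h).symm (S.σ g (g⁻¹ * h))) (W t (g⁻¹ * h)) := by
  classical
  let J : G → X →ₗ[ℂ] T := fun g =>
    { toFun := fun x => tmul (er.v g x) (Pi.single g 1)
      map_add' := fun x y => by rw [map_add, t_add_l _ _ _ (memAS_single S g 1)]
      map_smul' := fun c x => by
        rw [map_smul, t_smul _ _ _ (memAS_single S g 1), RingHom.id_apply] }
  have J_inner : ∀ g y x ξ, MemAS S ξ →
      hT.inner (J g y) (tmul x ξ) = (S.α g).symm (hX.inner (er.v g y) x * ξ g) := by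
    intro g y x ξ hξ
    refine (t_inner _ _ _ _ (memAS_single S g 1) hξ).trans ((tsum_eq_single g ?_).trans ?_)
    · intro h hh
      rw [Pi.single_eq_of_ne hh]
      simp
    · rw [Pi.single_eq_same, star_one, one_mul]
  have hJ : ∀ g x y, hT.inner (J g x) (J g y) = hX.inner x y := by
    intro g x y
    refine (J_inner g x _ _ (memAS_single S g 1)).trans ?_
    rw [Pi.single_eq_same, mul_one, ← er.v_inner, StarAlgEquiv.symm_apply_apply]
  have hJ' : ∀ g h x y, g ≠ h → hT.inner (J g x) (J h y) = 0 := by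
    intro g h x y hgh
    refine (J_inner g x _ _ (memAS_single S h 1)).trans ?_
    rw [Pi.single_eq_of_ne hgh, mul_zero, map_zero]
  have J_adj : ∀ g y x ξ, MemAS S ξ →
      hT.inner (J g y) (tmul x ξ) = hX.inner y ((er.v g).symm (hX.smulA x (ξ g))) := by
    intro g y x ξ hξ
    rw [J_inner g y x ξ hξ, er.inner_symm_right, hX.inner_smulA_right]
  have hex : ∀ g, ∃ L : T →L[ℂ] X, ∀ y t, hT.inner (J g y) t = hX.inner y (L t) := by
    refine fun g => hX.exists_adjoint hT (J g) (hJ g) _ t_dense ?_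
    rintro _ ⟨x, ξ, hξ, rfl⟩
    exact ⟨_, fun y => J_adj g y x ξ hξ⟩
  choose L hL using hex
  have L_tmul : ∀ g x ξ, MemAS S ξ → L g (tmul x ξ) = (er.v g).symm (hX.smulA x (ξ g)) :=
    fun g x ξ hξ => hX.ext_inner fun y => by rw [← hL, J_adj g y x ξ hξ]
  have L_J : ∀ g x, L g (J g x) = x := fun g x => hX.ext_inner fun y => by rw [← hL, hJ]
  have L_J' : ∀ g h x, g ≠ h → L g (J h x) = 0 := fun g h x hgh => hX.ext_inner fun y => by
    rw [← hL, hJ' g h y x hgh, hX.inner_zero_right]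
  have expand : ∀ t, HasSum (fun g => J g (L g t)) t := by
    refine hX.hasSum_of_dense hT J hJ hJ' L hL _ t_dense ?_
    rintro _ ⟨x, ξ, hξ, rfl⟩
    rw [t_inner x x ξ ξ hξ hξ]
    refine (hξ.summable_conj_inner hX x).hasSum.congr_fun fun g => ?_
    rw [L_tmul g x ξ hξ, er.inner_symm_symm, hX.inner_smulA_right, hX.inner_smulA_left, mul_assoc]
  have parseval : ∀ t t', HasSum (fun g => hX.inner (L g t) (L g t')) (hT.inner t t') :=
    fun t t' => hX.hasSum_inner hT J L hL (expand t') t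
  refine ⟨fun t g => L g t, fun t => (parseval t t).summable, ?_, ?_, ?_, ?_, ?_, ?_, ?_, ?_, ?_⟩
  · intro ζ hζ
    have hs := hX.summable_of_summable_inner hT J hJ hJ' ζ hζ
    refine ⟨∑' g, J g (ζ g), funext fun h => ?_⟩
    refine (hs.hasSum.mapL (L h)).unique ?_
    convert hasSum_single (f := fun g => L h (J g (ζ g))) h ?_ using 1
    · exact (L_J h _).symm
    · exact fun g hg => L_J' h g _ hg.symm
  · intro t t' h
    have h' := expand t'
    have hg : ∀ g, L g t' = L g t := fun g => (congrFun h g).symm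
    simp only [hg] at h'
    exact (expand t).unique h'
  · exact fun t t' => funext fun g => map_add (L g) t t'
  · exact fun c t => funext fun g => map_smul (L g) c t
  · exact fun t a => funext fun g => hX.ext_inner fun y => by
      rw [← hL, hT.inner_smulA_right, hX.inner_smulA_right, hL]
  · exact fun t t' => (parseval t t').tsum_eq.symm
  · exact fun x ξ hξ g => L_tmul g x ξ hξ
  · intro a t g
    have h : (L g).comp (P a) = (er.ρ ((S.α g).symm a)).comp (L g) := by
      refine ContinuousLinearMap.ext_on t_dense ?_
      rintro _ ⟨x, ξ, hξ, rfl⟩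
      rw [ContinuousLinearMap.comp_apply, ContinuousLinearMap.comp_apply, hP a x ξ hξ,
        L_tmul _ _ _ hξ, L_tmul _ _ _ hξ, ← er.symm_rho, er.rho_smulA]
    exact DFunLike.congr_fun h t
  · intro g t h
    have h' : (L h).comp (Vop g)
        = (er.ρ ((S.α h).symm (S.σ g (g⁻¹ * h)))).comp (L (g⁻¹ * h)) := by
      refine ContinuousLinearMap.ext_on t_dense ?_
      rintro _ ⟨x, ξ, hξ, rfl⟩
      have hk := er.symm_v_smulA_sigma g (g⁻¹ * h) x (ξ (g⁻¹ * h))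
      rw [mul_inv_cancel_left] at hk
      rw [ContinuousLinearMap.comp_apply, ContinuousLinearMap.comp_apply, hVop g x ξ hξ,
        L_tmul _ _ _ (hξ.lambda g), L_tmul _ _ _ hξ, hk]
    exact DFunLike.congr_fun h' t

end BCFourier
end
end

section
/- Let κ : G → [1,∞) and assume Σ has the A^Σ_κ-decay property (w.r.t. ‖·‖_{α,κ}) with decay constant C. Let ψ ∈ ℓ∞_κ(G,A), with K := sup_{g∈G} ‖ψ(g)κ(g)‖ < ∞, and let L^ψ : G × A → A be given by L^ψ(g,a) = ψ(g)a. Then L^ψ ∈ MCF(Σ) with ‖|L^ψ|‖ ≤ CK. -/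
open scoped ComplexOrder

noncomputable section

namespace BCFourier

variable {A G B : Type*} [CStarAlgebra A] [Group G] [CStarAlgebra B]

variable {S : TwistedSystem A G}

/-- A family of positive elements of a C*-algebra dominated termwise by a multiple of another
family has dominated finite partial sums in norm. -/
theorem norm_sum_le_of_le_smul {ι A : Type*} [CStarAlgebra A] [PartialOrder A]
    [StarOrderedRing A] {f p : ι → A} {c : ℝ} (hc : 0 ≤ c) (hf : ∀ i, 0 ≤ f i)
    (hfp : ∀ i, f i ≤ c • p i) (s : Finset ι) :
    ‖∑ i ∈ s, f i‖ ≤ c * ‖∑ i ∈ s, p i‖ := by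
  calc ‖∑ i ∈ s, f i‖ ≤ ‖c • ∑ i ∈ s, p i‖ := by
        refine CStarAlgebra.norm_le_norm_of_nonneg_of_le
          (Finset.sum_nonneg fun i _ => hf i) ?_
        rw [Finset.smul_sum]
        exact Finset.sum_le_sum fun i _ => hfp i
    _ = c * ‖∑ i ∈ s, p i‖ := by rw [norm_smul, Real.norm_of_nonneg hc]

/-- Left multiplication by `b` increases `α⁻¹(a* a)` at most by the factor `‖b‖²`. -/
theorem symm_star_mul_self_le {A : Type*} [CStarAlgebra A] [PartialOrder A]
    [StarOrderedRing A] (φ : A ≃⋆ₐ[ℂ] A) (b a : A) {k K : ℝ} (hk : 0 ≤ k)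
    (hK : ‖b‖ * k ≤ K) :
    k ^ 2 • φ.symm (star (b * a) * (b * a)) ≤ K ^ 2 • φ.symm (star a * a) := by
  have h1 : star (b * a) * (b * a) ≤ (‖b‖ ^ 2) • (star a * a) := by
    have h := CStarAlgebra.star_left_conjugate_le_norm_smul (a := a) (b := star b * b)
    rw [CStarRing.norm_star_mul_self, ← sq] at h
    simpa [mul_assoc] using h
  have h2 : φ.symm (star (b * a) * (b * a)) ≤ (‖b‖ ^ 2) • φ.symm (star a * a) := by
    have h := OrderHomClass.mono φ.symm h1
    have h3 : φ.symm ((‖b‖ ^ 2) • (star a * a)) = (‖b‖ ^ 2) • φ.symm (star a * a) := by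
      rw [← Complex.coe_smul, map_smul, Complex.coe_smul]
    rwa [h3] at h
  have hpos : 0 ≤ φ.symm (star a * a) := by
    rw [map_mul, map_star]
    exact star_mul_self_nonneg _
  calc k ^ 2 • φ.symm (star (b * a) * (b * a))
      ≤ k ^ 2 • ((‖b‖ ^ 2) • φ.symm (star a * a)) := smul_le_smul_of_nonneg_left h2 (sq_nonneg k)
    _ = (‖b‖ * k) ^ 2 • φ.symm (star a * a) := by rw [smul_smul]; ring_nf
    _ ≤ K ^ 2 • φ.symm (star a * a) := by
      refine smul_le_smul_of_nonneg_right ?_ hpos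
      gcongr

/-- A series whose finite sums are bounded by a multiple of the square root of those of a
summable family converges unconditionally. -/
theorem summable_of_norm_sum_le {ι E F : Type*} [SeminormedAddCommGroup E]
    [CompleteSpace E] [SeminormedAddCommGroup F] [CompleteSpace F] {b : ι → F} {p : ι → E}
    (hp : Summable p) {c : ℝ} (hc : 0 ≤ c)
    (h : ∀ s : Finset ι, ‖∑ i ∈ s, b i‖ ≤ c * Real.sqrt ‖∑ i ∈ s, p i‖) :
    Summable b := by
  rw [summable_iff_vanishing_norm] at hp ⊢
  intro ε hε
  obtain ⟨s, hs⟩ := hp ((ε / (c + 1)) ^ 2) (by positivity)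
  refine ⟨s, fun t ht => (h t).trans_lt ?_⟩
  have h1 : Real.sqrt ‖∑ i ∈ t, p i‖ < ε / (c + 1) :=
    (Real.sqrt_lt' (by positivity)).2 (hs t ht)
  calc c * Real.sqrt ‖∑ i ∈ t, p i‖ ≤ c * (ε / (c + 1)) := by gcongr
    _ < (c + 1) * (ε / (c + 1)) := by gcongr; linarith
    _ = ε := by field_simp

/-- The conditional expectation picks out the coefficient of `a u_h` at `g`. -/
theorem hatF_single [DecidableEq G] (D : CrossedProduct S B) (a : A) (h g : G) :
    hatF D (D.ι a * D.u h) g = if h = g then a else 0 := by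
  unfold hatF
  split_ifs with hg
  · subst hg
    rw [mul_assoc, Unitary.mul_star_self_of_mem (D.u_unitary h), mul_one, D.E_iota]
  · have hmul := D.u_mul (h * g⁻¹) g
    rw [inv_mul_cancel_right] at hmul
    have hσ : D.ι (star (S.σ (h * g⁻¹) g)) * D.ι (S.σ (h * g⁻¹) g) = 1 := by
      rw [← map_mul, Unitary.star_mul_self_of_mem (S.σ_unitary _ _), map_one]
    have hu : D.u h * star (D.u g) = D.ι (star (S.σ (h * g⁻¹) g)) * D.u (h * g⁻¹) := by
      calc D.u h * star (D.u g)
          = (D.ι (star (S.σ (h * g⁻¹) g)) * D.ι (S.σ (h * g⁻¹) g)) * D.u h * star (D.u g) := by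
            rw [hσ, one_mul]
        _ = D.ι (star (S.σ (h * g⁻¹) g)) * D.u (h * g⁻¹) * (D.u g * star (D.u g)) := by
            rw [mul_assoc (D.ι _) (D.ι _), ← hmul]; simp only [mul_assoc]
        _ = _ := by rw [Unitary.mul_star_self_of_mem (D.u_unitary g), mul_one]
    rw [mul_assoc, hu, ← mul_assoc, ← map_mul]
    exact D.E_perp _ _ (by rwa [ne_eq, mul_inv_eq_one])

/-- The Fourier coefficients of an unconditionally convergent series are its coefficients. -/
theorem hatF_eq_of_hasSum (D : CrossedProduct S B) {ξ : G → A} {y : B}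
    (hy : HasSum (fun h => D.ι (ξ h) * D.u h) y) : hatF D y = ξ := by
  classical
  funext g
  have h1 : HasSum (fun h => hatF D (D.ι (ξ h) * D.u h) g) (hatF D y g) :=
    (hy.mul_right (star (D.u g))).mapL D.E
  simp only [hatF_single] at h1
  refine h1.unique ?_
  have h2 := hasSum_single (f := fun h => if h = g then ξ h else 0) g fun h hg => if_neg hg
  simpa using h2

/-- `Λ_Σ` of the restriction of `ξ` to a finite set. -/
theorem Lam_indicator (D : CrossedProduct S B) (ξ : G → A) (F : Finset G) :
    Lam D (Set.indicator (↑F : Set G) ξ) = ∑ g ∈ F, D.ι (ξ g) * D.u g := by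
  classical
  unfold Lam
  rw [finsum_eq_sum_of_support_subset (s := F)]
  · refine Finset.sum_congr rfl fun g hg => ?_
    rw [Set.indicator_of_mem (Finset.mem_coe.2 hg)]
  · intro g hg
    by_contra hgF
    exact hg (by simp [Set.indicator_of_notMem hgF])

/-- The decay inequality bounds the finite Fourier sums of `ψ ξ` by those of `⟨ξ, ξ⟩_α`. -/
theorem norm_sum_mul_le (D : CrossedProduct S B) {κ : G → ℝ} (hκ : ∀ g, 1 ≤ κ g) {C : ℝ}
    (hC : 0 < C)
    (hdec : ∀ f : G → A, (Function.support f).Finite →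
      ‖Lam D f‖ ≤ C * Real.sqrt ‖∑' g, ((κ g ^ 2 : ℝ) : ℂ) • (S.α g).symm (star (f g) * f g)‖)
    {ψ : G → A} {K : ℝ} (hK0 : 0 ≤ K) (hK : ∀ g, ‖ψ g‖ * κ g ≤ K) (ξ : G → A) (F : Finset G) :
    ‖∑ g ∈ F, D.ι (ψ g * ξ g) * D.u g‖
      ≤ C * K * Real.sqrt ‖∑ g ∈ F, (S.α g).symm (star (ξ g) * ξ g)‖ := by
  let := CStarAlgebra.spectralOrder A
  have := CStarAlgebra.spectralOrderedRing A
  set f : G → A := Set.indicator (↑F : Set G) fun g => ψ g * ξ g with hf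
  have hfin : (Function.support f).Finite :=
    F.finite_toSet.subset Set.support_indicator_subset
  have hsum : ∑' g, ((κ g ^ 2 : ℝ) : ℂ) • (S.α g).symm (star (f g) * f g)
      = ∑ g ∈ F, κ g ^ 2 • (S.α g).symm (star (ψ g * ξ g) * (ψ g * ξ g)) := by
    rw [tsum_eq_sum (s := F)]
    · refine Finset.sum_congr rfl fun g hg => ?_
      rw [hf, Set.indicator_of_mem (Finset.mem_coe.2 hg), Complex.coe_smul]
    · intro g hg
      rw [hf, Set.indicator_of_notMem (by simpa using hg)]
      simp
  have hle : ‖∑ g ∈ F, κ g ^ 2 • (S.α g).symm (star (ψ g * ξ g) * (ψ g * ξ g))‖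
      ≤ K ^ 2 * ‖∑ g ∈ F, (S.α g).symm (star (ξ g) * ξ g)‖ := by
    refine norm_sum_le_of_le_smul (sq_nonneg K) (fun g => ?_) (fun g => ?_) F
    · rw [map_mul, map_star]
      exact smul_nonneg (sq_nonneg _) (star_mul_self_nonneg _)
    · exact symm_star_mul_self_le (S.α g) _ _ (zero_le_one.trans (hκ g)) (hK g)
  have h := hdec f hfin
  rw [hsum, hf, Lam_indicator] at h
  refine h.trans ?_
  rw [mul_assoc]
  gcongr
  refine (Real.sqrt_le_sqrt hle).trans_eq ?_
  rw [Real.sqrt_mul (sq_nonneg K), Real.sqrt_sq hK0]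

/-- The series defining `⟨x̂, x̂⟩_α` converges to `E(x* x)`. -/
theorem hasSum_hatF (D : CrossedProduct S B) (x : B) :
    HasSum (fun g => (S.α g).symm (star (hatF D x g) * hatF D x g)) (D.E (star x * x)) := by
  rw [D.E_inner x]
  exact (D.hat_mem x).hasSum

/-- The norm `‖·‖_α` is dominated by the C*-norm. -/
theorem sqrt_norm_E_le (D : CrossedProduct S B) (x : B) :
    Real.sqrt ‖D.E (star x * x)‖ ≤ ‖x‖ := by
  rw [← Real.sqrt_mul_self (norm_nonneg x), ← CStarRing.norm_star_mul_self]
  exact Real.sqrt_le_sqrt (D.E_contractive _)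

/-- Proposition `CK`. If `Σ` has the `A^Σ_κ`-decay property
with decay constant `C` and `ψ ∈ ℓ∞_κ(G,A)` with `K = sup_g ‖ψ(g)κ(g)‖`, then
`L^ψ ∈ MCF(Σ)` with `‖|L^ψ|‖ ≤ CK`. -/
theorem statement11 {A G B : Type*} [CStarAlgebra A] [Group G] [CStarAlgebra B]
    (S : TwistedSystem A G) (D : CrossedProduct S B)
    (κ : G → ℝ) (hκ : ∀ g, 1 ≤ κ g) (C : ℝ) (hC : 0 < C)
    -- `Σ` has the `A^Σ_κ`-decay property w.r.t. `‖·‖_{α,κ}` with constant `C`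
    (hdec1 : ∀ ξ : G → A,
      Summable (fun g => ((κ g ^ 2 : ℝ) : ℂ) • (S.α g).symm (star (ξ g) * ξ g)) →
      TendsZeroAtInfty
        (fun η => Real.sqrt ‖∑' g, ((κ g ^ 2 : ℝ) : ℂ) • (S.α g).symm (star (η g) * η g)‖)
        ξ)
    (hdec2 : ∀ f : G → A, (Function.support f).Finite →
      ‖Lam D f‖ ≤ C * Real.sqrt ‖∑' g, ((κ g ^ 2 : ℝ) : ℂ) • (S.α g).symm (star (f g) * f g)‖)
    -- `ψ ∈ ℓ∞_κ(G,A)`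
    (ψ : G → A) (hψ : BddAbove (Set.range fun g => ‖ψ g‖ * κ g)) :
    ∃ M : B →L[ℂ] B,
      IsMultiplier D (fun g a => ψ g * a) M ∧
      ‖M‖ ≤ C * ⨆ g, ‖ψ g‖ * κ g ∧
      ∀ x : B, CFmem D (M x) := by
  classical
  set K : ℝ := ⨆ g, ‖ψ g‖ * κ g with hKdef
  have hK : ∀ g, ‖ψ g‖ * κ g ≤ K := fun g => le_ciSup hψ g
  have hK0 : 0 ≤ K :=
    (mul_nonneg (norm_nonneg _) (zero_le_one.trans (hκ 1))).trans (hK 1)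
  have hCK : 0 ≤ C * K := mul_nonneg hC.le hK0
  have hbound := norm_sum_mul_le D hκ hC hdec2 hK0 hK
  have hs : ∀ x : B, Summable fun g => D.ι (ψ g * hatF D x g) * D.u g := fun x =>
    summable_of_norm_sum_le (hasSum_hatF D x).summable hCK (hbound (hatF D x))
  let M₀ : B →ₗ[ℂ] B :=
    { toFun := fun x => ∑' g, D.ι (ψ g * hatF D x g) * D.u g
      map_add' := fun x y => by
        rw [← (hs x).tsum_add (hs y)]
        refine tsum_congr fun g => ?_
        simp only [hatF, add_mul, map_add, mul_add]
      map_smul' := fun c x => by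
        rw [RingHom.id_apply, ← (hs x).tsum_const_smul c]
        refine tsum_congr fun g => ?_
        simp only [hatF, smul_mul_assoc, map_smul, mul_smul_comm] }
  have hM : ∀ x, HasSum (fun g => D.ι (ψ g * hatF D x g) * D.u g) (M₀ x) := fun x => (hs x).hasSum
  have hnorm : ∀ x, ‖M₀ x‖ ≤ C * K * ‖x‖ := fun x => by
    have h1 : ‖M₀ x‖ ≤ C * K * Real.sqrt ‖D.E (star x * x)‖ :=
      le_of_tendsto_of_tendsto' (hM x).norm
        (((Real.continuous_sqrt.tendsto _).comp (hasSum_hatF D x).norm).const_mul (C * K))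
        (hbound (hatF D x))
    exact h1.trans (mul_le_mul_of_nonneg_left (sqrt_norm_E_le D x) hCK)
  refine ⟨M₀.mkContinuous (C * K) hnorm, ⟨fun g => ?_, fun g a => ?_⟩,
    M₀.mkContinuous_norm_le hCK hnorm, fun x => ⟨M₀ x, ?_⟩⟩
  · exact ⟨fun a b => mul_add _ _ _, fun c a => mul_smul_comm _ _ _⟩
  · refine (hM _).unique ?_
    have h := hasSum_single (f := fun h => D.ι (ψ h * hatF D (D.ι a * D.u g) h) * D.u h) g
      fun h hg => by simp [hatF_single, Ne.symm hg]
    simpa [hatF_single] using h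
  · rw [LinearMap.mkContinuous_apply, hatF_eq_of_hasSum D (hM x)]
    exact hM x

end BCFourier
end
end

section
/- Let J be an α-invariant closed two-sided ideal of A. Then ⟨J⟩ ⊆ J̃ ⊆ J̌. If, moreover, there exists a Fourier summing net {T^i} for Σ that preserves J (i.e. T^i_g(J) ⊆ J for all i and all g ∈ G), then ⟨J⟩ = J̃ = J̌. -/
open scoped ComplexOrder

noncomputable section

namespace BCFourier

variable {A G B : Type*} [CStarAlgebra A] [Group G] [CStarAlgebra B]

variable {S : TwistedSystem A G}

namespace CrossedProduct

/-- Bounded linear maps agreeing on the elements `ι a * u g` agree everywhere. -/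
theorem eq_of_continuous_of_gen (D : CrossedProduct S B) {V : Type*} [AddCommGroup V]
    [Module ℂ V] [TopologicalSpace V] [T2Space V] {f h : B →ₗ[ℂ] V} (hf : Continuous f)
    (hh : Continuous h) (H : ∀ a g, f (D.ι a * D.u g) = h (D.ι a * D.u g)) (x : B) :
    f x = h x := by
  have hfh : Set.EqOn f h (Submodule.span ℂ {b : B | ∃ a g, b = D.ι a * D.u g} : Set B) := by
    refine LinearMap.eqOn_span' ?_
    rintro _ ⟨a, g, rfl⟩
    exact H a g
  exact congrFun (Continuous.ext_on D.generated hf hh hfh) x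

theorem u_mul_star_u (D : CrossedProduct S B) (h g : G) :
    D.u h * star (D.u g) = D.ι (star (S.σ (h * g⁻¹) g)) * D.u (h * g⁻¹) := by
  have h1 := D.u_mul (h * g⁻¹) g
  rw [inv_mul_cancel_right] at h1
  have h2 : D.u h = D.ι (star (S.σ (h * g⁻¹) g)) * (D.u (h * g⁻¹) * D.u g) := by
    rw [h1, ← mul_assoc, ← map_mul, (Unitary.mem_iff.mp (S.σ_unitary _ _)).1, map_one, one_mul]
  nth_rw 1 [h2]
  rw [mul_assoc, mul_assoc, (Unitary.mem_iff.mp (D.u_unitary g)).2, mul_one]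

theorem hatF_gen_self (D : CrossedProduct S B) (a : A) (g : G) :
    hatF D (D.ι a * D.u g) g = a := by
  rw [hatF, mul_assoc, (Unitary.mem_iff.mp (D.u_unitary g)).2, mul_one, D.E_iota]

theorem hatF_gen_of_ne (D : CrossedProduct S B) (a : A) {h g : G} (hg : h ≠ g) :
    hatF D (D.ι a * D.u h) g = 0 := by
  rw [hatF, mul_assoc, D.u_mul_star_u, ← mul_assoc, ← map_mul]
  exact D.E_perp _ _ fun h1 => hg (mul_inv_eq_one.mp h1)

/-- The `g`-th Fourier coefficient as a bounded linear map. -/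
def hatCLM (D : CrossedProduct S B) (g : G) : B →L[ℂ] A :=
  D.E.comp ((ContinuousLinearMap.mul ℂ B).flip (star (D.u g)))

theorem hatCLM_apply (D : CrossedProduct S B) (g : G) (x : B) : D.hatCLM g x = hatF D x g := rfl

theorem hatF_injective (D : CrossedProduct S B) : Function.Injective (hatF D) := by
  intro x y hxy
  have h0 : ∀ g, D.E ((x - y) * star (D.u g)) = 0 := fun g => by
    change D.hatCLM g (x - y) = 0
    rw [map_sub, sub_eq_zero]
    exact congrFun hxy g
  refine sub_eq_zero.mp (D.E_faithful _ ?_)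
  rw [D.E_inner]
  simp [innerAS, h0]

/-- If the Fourier series of `x` converges unconditionally, then its sum is `x`. -/
theorem hasSum_of_CFmem (D : CrossedProduct S B) {x : B} (hx : CFmem D x) :
    HasSum (fun g => D.ι (hatF D x g) * D.u g) x := by
  obtain ⟨y, hy⟩ := hx
  have hyx : y = x := by
    refine D.hatF_injective (funext fun g => ?_)
    have h1 := (D.hatCLM g).hasSum hy
    have h2 : HasSum (fun h => D.hatCLM g (D.ι (hatF D x h) * D.u h))
        (D.hatCLM g (D.ι (hatF D x g) * D.u g)) :=
      hasSum_single g fun h hh => D.hatF_gen_of_ne _ hh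
    exact (h1.unique h2).trans (D.hatF_gen_self _ _)
  exact hyx ▸ hy

/-- A multiplier acts coefficientwise on Fourier transforms. -/
theorem hatF_multiplier (D : CrossedProduct S B) {T : G → A → A} {M : B →L[ℂ] B}
    (hT : IsMultiplier D T M) (x : B) (g : G) : hatF D (M x) g = T g (hatF D x g) := by
  have hι : Continuous D.ι := (AddMonoidHomClass.isometry_of_norm D.ι D.ι_isometric).continuous
  have hTg : ∀ a, T g a = D.hatCLM g (M (D.ι a * D.u g)) := fun a => by
    rw [hT.2, hatCLM_apply, hatF_gen_self]
  have hTc : Continuous (T g) := by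
    rw [funext hTg]
    fun_prop
  have key := D.eq_of_continuous_of_gen (f := ((D.hatCLM g).comp M : B →L[ℂ] A).toLinearMap)
    (h := (hT.1 g).mk' (T g) ∘ₗ (D.hatCLM g).toLinearMap)
    ((D.hatCLM g).comp M).continuous (hTc.comp (D.hatCLM g).continuous) ?_ x
  · exact key
  · intro a h
    change hatF D (M (D.ι a * D.u h)) g = T g (hatF D (D.ι a * D.u h) g)
    rw [hT.2]
    rcases eq_or_ne h g with rfl | hg
    · rw [hatF_gen_self, hatF_gen_self]
    · rw [D.hatF_gen_of_ne _ hg, D.hatF_gen_of_ne _ hg, (hT.1 g).map_zero]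

end CrossedProduct

theorem mem_genIdeal_of_CFmem (D : CrossedProduct S B) {J : Set A} {x : B} (hx : CFmem D x)
    (hJ : ∀ g, hatF D x g ∈ J) : x ∈ genIdeal D J := by
  refine mem_closure_of_tendsto (D.hasSum_of_CFmem hx) (Filter.Eventually.of_forall fun F => ?_)
  refine Submodule.sum_mem _ fun g _ => Submodule.subset_span ?_
  exact ⟨1, D.u g, _, hJ g, by rw [one_mul]⟩

theorem FSNet.mem_genIdeal {D : CrossedProduct S B} (net : FSNet D) {J : Set A}
    (hnet : ∀ i g, ∀ a ∈ J, net.T i g a ∈ J) {x : B} (hx : ∀ g, hatF D x g ∈ J) :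
    x ∈ genIdeal D J := by
  let := net.pre
  have : IsDirected net.Idx (· ≤ ·) := net.dir
  have := net.nonempty
  have hlim : Filter.Tendsto (fun i => net.M i x) Filter.atTop (nhds x) :=
    tendsto_iff_norm_sub_tendsto_zero.mpr (net.M_lim x)
  have hmem : ∀ i, net.M i x ∈ genIdeal D J := fun i =>
    mem_genIdeal_of_CFmem D (net.M_cf i x) fun g => by
      rw [D.hatF_multiplier ⟨net.T_lin i, net.M_mult i⟩]
      exact hnet i g _ (hx g)
  exact isClosed_closure.mem_of_tendsto hlim (Filter.Eventually.of_forall hmem)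

namespace QuotientData

variable {D : CrossedProduct S B} {J : Set A} (qd : QuotientData D J)

/-- The quotient map `q : A → A/J` as a unital `*`-homomorphism. -/
def qHom : A →⋆ₐ[ℂ] qd.Aq where
  toFun := qd.q
  map_one' := qd.q_one
  map_mul' := qd.q_mul
  map_zero' := by simpa using qd.q_smul 0 0
  map_add' := qd.q_add
  commutes' c := by rw [Algebra.algebraMap_eq_smul_one, qd.q_smul, qd.q_one,
    Algebra.algebraMap_eq_smul_one]
  map_star' := qd.q_star

/-- The canonical map `q̃` between the crossed products as a linear map. -/
def QLin : B →ₗ[ℂ] qd.Bq where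
  toFun := qd.Q
  map_add' := qd.Q_add
  map_smul' := qd.Q_smul

theorem Q_iota (a : A) : qd.Q (D.ι a) = qd.Dq.ι (qd.q a) := by
  simpa [D.u_one, qd.Dq.u_one] using qd.Q_gen a 1

theorem Q_u (g : G) : qd.Q (D.u g) = qd.Dq.u g := by
  simpa [qd.q_one] using qd.Q_gen 1 g

/-- The quotient maps intertwine the conditional expectations. -/
theorem q_E (x : B) : qd.q (D.E x) = qd.Dq.E (qd.Q x) := by
  have hq : Continuous qd.qHom :=
    AddMonoidHomClass.continuous_of_bound qd.qHom 1 fun a => by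
      simpa using NonUnitalStarAlgHom.norm_apply_le qd.qHom a
  refine D.eq_of_continuous_of_gen (f := qd.qHom.toAlgHom.toLinearMap ∘ₗ D.E.toLinearMap)
    (h := qd.Dq.E.toLinearMap ∘ₗ qd.QLin) (hq.comp D.E.continuous)
    (qd.Dq.E.continuous.comp qd.Q_cont) (fun a g => ?_) x
  change qd.q (D.E (D.ι a * D.u g)) = qd.Dq.E (qd.Q (D.ι a * D.u g))
  rw [qd.Q_gen]
  rcases eq_or_ne g 1 with rfl | hg
  · rw [D.u_one, qd.Dq.u_one, mul_one, mul_one, D.E_iota, qd.Dq.E_iota]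
  · rw [D.E_perp _ _ hg, qd.Dq.E_perp _ _ hg]
    exact map_zero qd.qHom

theorem genIdeal_subset_ker : genIdeal D J ⊆ {x : B | qd.Q x = 0} := by
  refine closure_minimal ?_ (isClosed_singleton.preimage qd.Q_cont)
  change Submodule.span ℂ _ ≤ LinearMap.ker qd.QLin
  refine Submodule.span_le.mpr ?_
  rintro _ ⟨x, y, j, hj, rfl⟩
  change qd.Q (x * D.ι j * y) = 0
  rw [qd.Q_mul, qd.Q_mul, qd.Q_iota, (qd.q_ker j).mpr hj, map_zero, mul_zero, zero_mul]

theorem ker_subset_hatF_mem :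
    {x : B | qd.Q x = 0} ⊆ {x : B | ∀ g, hatF D x g ∈ J} := by
  intro x (hx : qd.Q x = 0) g
  rw [← qd.q_ker, hatF, qd.q_E, qd.Q_mul, hx, zero_mul, map_zero]

end QuotientData

/-- Proposition `ideals`. For an `α`-invariant closed
two-sided ideal `J` of `A` one has `⟨J⟩ ⊆ J̃ ⊆ J̌`, with equality throughout if
there exists a Fourier summing net for `Σ` preserving `J`. -/
theorem statement12 {A G B : Type*} [CStarAlgebra A] [Group G] [CStarAlgebra B]
    (S : TwistedSystem A G) (D : CrossedProduct S B)
    (J : Set A) (hJ : IsInvIdeal S J) (qd : QuotientData D J) :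
    (genIdeal D J ⊆ {x : B | qd.Q x = 0} ∧
      {x : B | qd.Q x = 0} ⊆ {x : B | ∀ g, hatF D x g ∈ J}) ∧
    ((∃ net : FSNet D, ∀ i g, ∀ a ∈ J, net.T i g a ∈ J) →
      genIdeal D J = {x : B | qd.Q x = 0} ∧
      {x : B | qd.Q x = 0} = {x : B | ∀ g, hatF D x g ∈ J}) := by
  refine ⟨⟨qd.genIdeal_subset_ker, qd.ker_subset_hatF_mem⟩, ?_⟩
  rintro ⟨net, hnet⟩
  have h : {x : B | ∀ g, hatF D x g ∈ J} ⊆ genIdeal D J := fun _ hx => net.mem_genIdeal hnet hx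
  exact ⟨qd.genIdeal_subset_ker.antisymm (qd.ker_subset_hatF_mem.trans h),
    qd.ker_subset_hatF_mem.antisymm (h.trans qd.genIdeal_subset_ker)⟩

end BCFourier
end
end

section
/- Assume there exists a Fourier summing net for Σ that preserves the invariant ideals of A. Then Σ is exact, i.e. ⟨J⟩ = J̃ for every α-invariant closed two-sided ideal J of A. -/
open scoped ComplexOrder

noncomputable section

namespace BCFourier

variable {A G B : Type*} [CStarAlgebra A] [Group G] [CStarAlgebra B]

variable {S : TwistedSystem A G}

section FourierCoefficients

variable (D : CrossedProduct S B)

/-- Two continuous linear maps agreeing on the elements `ι a * u g` are equal. -/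
theorem CrossedProduct.clm_ext {F : Type*} [NormedAddCommGroup F] [NormedSpace ℂ F]
    {φ ψ : B →L[ℂ] F} (h : ∀ a g, φ (D.ι a * D.u g) = ψ (D.ι a * D.u g)) : φ = ψ := by
  refine ContinuousLinearMap.ext_on D.generated ?_
  rintro _ ⟨a, g, rfl⟩
  exact h a g

theorem CrossedProduct.u_mul_star_self (g : G) : D.u g * star (D.u g) = 1 :=
  Unitary.mul_star_self_of_mem (D.u_unitary g)

theorem CrossedProduct.u_mul_star (h g : G) :
    D.u h * star (D.u g) = D.ι (star (S.σ (h * g⁻¹) g)) * D.u (h * g⁻¹) := by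
  have hσ : star (S.σ (h * g⁻¹) g) * S.σ (h * g⁻¹) g = 1 :=
    Unitary.star_mul_self_of_mem (S.σ_unitary _ _)
  have hu : D.u h = D.ι (star (S.σ (h * g⁻¹) g)) * (D.u (h * g⁻¹) * D.u g) := by
    rw [D.u_mul, ← mul_assoc, ← map_mul, hσ, map_one, one_mul, inv_mul_cancel_right]
  rw [hu, mul_assoc, mul_assoc, D.u_mul_star_self, mul_one]

/-- The `g`-th Fourier coefficient as a continuous linear map. -/
def hatCLM (g : G) : B →L[ℂ] A :=
  D.E.comp ((ContinuousLinearMap.mul ℂ B).flip (star (D.u g)))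

theorem hatCLM_apply (g : G) (x : B) : hatCLM D g x = hatF D x g := rfl

theorem hatCLM_gen_self (a : A) (g : G) : hatCLM D g (D.ι a * D.u g) = a := by
  simp only [hatCLM_apply, hatF]
  rw [mul_assoc, D.u_mul_star_self, mul_one, D.E_iota]

theorem hatCLM_gen_of_ne (a : A) {g h : G} (hgh : h ≠ g) :
    hatCLM D g (D.ι a * D.u h) = 0 := by
  simp only [hatCLM_apply, hatF]
  rw [mul_assoc, D.u_mul_star, ← mul_assoc, ← map_mul]
  exact D.E_perp _ _ (by rwa [ne_eq, mul_inv_eq_one])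

variable {D}

/-- An element of the crossed product is determined by its Fourier coefficients. -/
theorem eq_of_hatCLM_eq {x y : B} (h : ∀ g, hatCLM D g x = hatCLM D g y) : x = y := by
  have h0 : ∀ g, D.E ((x - y) * star (D.u g)) = 0 := fun g => by
    have := map_sub (hatCLM D g) x y
    rwa [h g, sub_self] at this
  refine sub_eq_zero.mp (D.E_faithful _ ?_)
  rw [D.E_inner]
  simp [innerAS, h0]

/-- The sum of the Fourier series of an element of `CF(Σ)` is the element itself. -/
theorem CFmem.hasSum {x : B} (hx : CFmem D x) :
    HasSum (fun g => D.ι (hatF D x g) * D.u g) x := by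
  obtain ⟨y, hy⟩ := hx
  suffices hyx : y = x by rwa [hyx] at hy
  refine eq_of_hatCLM_eq (D := D) fun g => ?_
  refine (hy.mapL (hatCLM D g)).unique ?_
  have hg : hatCLM D g x = hatCLM D g (D.ι (hatF D x g) * D.u g) := by
    rw [hatCLM_gen_self, hatCLM_apply]
  rw [hg]
  exact hasSum_single g fun h hne => hatCLM_gen_of_ne D _ hne

/-- A multiplier acts coefficientwise on Fourier transforms. -/
theorem IsMultiplier.hatF_apply {T : G → A → A} {M : B →L[ℂ] B} (hT : IsMultiplier D T M)
    (x : B) (g : G) : hatF D (M x) g = T g (hatF D x g) := by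
  let inc : A →L[ℂ] B :=
    ⟨{ toFun := fun a => D.ι a * D.u g
       map_add' := fun a b => by rw [map_add, add_mul]
       map_smul' := fun c a => by simp [map_smul] },
      ((AddMonoidHomClass.isometry_of_norm D.ι D.ι_isometric).continuous.mul
        continuous_const)⟩
  have hinc : ∀ a, inc a = D.ι a * D.u g := fun _ => rfl
  have hTg : ∀ a, (hatCLM D g) (M (inc a)) = T g a := fun a => by
    rw [hinc, hT.2, hatCLM_gen_self]
  have key : (hatCLM D g).comp M =
      ((hatCLM D g).comp (M.comp inc)).comp (hatCLM D g) := by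
    refine D.clm_ext fun a h => ?_
    simp only [ContinuousLinearMap.comp_apply, hTg, hT.2]
    by_cases hgh : h = g
    · subst hgh
      rw [hatCLM_gen_self, hatCLM_gen_self]
    · rw [hatCLM_gen_of_ne D _ hgh, hatCLM_gen_of_ne D _ hgh, (hT.1 g).map_zero]
  have := DFunLike.congr_fun key x
  simpa only [ContinuousLinearMap.comp_apply, hTg, hatCLM_apply] using this

end FourierCoefficients

section InducedIdeals

variable {D : CrossedProduct S B} {J : Set A}

/-- If the Fourier coefficients of `x ∈ CF(Σ)` lie in `J`, then `x ∈ ⟨J⟩`. -/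
theorem CFmem.mem_genIdeal {x : B} (hx : CFmem D x) (h : ∀ g, hatF D x g ∈ J) :
    x ∈ genIdeal D J := by
  refine isClosed_closure.mem_of_tendsto hx.hasSum (Filter.Eventually.of_forall fun F => ?_)
  refine subset_closure (Submodule.sum_mem _ fun g _ => Submodule.subset_span ?_)
  exact ⟨1, D.u g, _, h g, by rw [one_mul]⟩

/-- The quotient map `A → A/J` as a `⋆`-homomorphism. -/
def QuotientData.qHom_s14 (qd : QuotientData D J) : A →⋆ₙₐ[ℂ] qd.Aq where
  toFun := qd.q
  map_smul' := qd.q_smul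
  map_zero' := by simpa using qd.q_smul 0 0
  map_add' := qd.q_add
  map_mul' := qd.q_mul
  map_star' := qd.q_star

/-- The quotient map `A → A/J` as a continuous linear map. -/
def QuotientData.qCLM (qd : QuotientData D J) : A →L[ℂ] qd.Aq :=
  ⟨⟨⟨qd.q, qd.q_add⟩, qd.q_smul⟩,
    AddMonoidHomClass.continuous_of_bound qd.qHom_s14 1 fun a => by
      simpa only [one_mul] using NonUnitalStarAlgHom.norm_apply_le qd.qHom_s14 a⟩

/-- The canonical map `q̃` as a continuous linear map. -/
def QuotientData.QCLM (qd : QuotientData D J) : B →L[ℂ] qd.Bq :=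
  ⟨⟨⟨qd.Q, qd.Q_add⟩, qd.Q_smul⟩, qd.Q_cont⟩

/-- The canonical map `q̃` intertwines the conditional expectations. -/
theorem QuotientData.q_E_s14 (qd : QuotientData D J) (x : B) :
    qd.q (D.E x) = qd.Dq.E (qd.Q x) := by
  have key : qd.qCLM.comp D.E = qd.Dq.E.comp qd.QCLM := by
    refine D.clm_ext fun a g => ?_
    change qd.q (D.E (D.ι a * D.u g)) = qd.Dq.E (qd.Q (D.ι a * D.u g))
    rw [qd.Q_gen]
    by_cases hg : g = 1
    · subst hg
      rw [D.u_one, qd.Dq.u_one, mul_one, mul_one, D.E_iota, qd.Dq.E_iota]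
    · rw [D.E_perp _ _ hg, qd.Dq.E_perp _ _ hg]
      exact map_zero qd.qHom_s14
  exact DFunLike.congr_fun key x

theorem QuotientData.Q_zero (qd : QuotientData D J) : qd.Q 0 = 0 := map_zero qd.QCLM

theorem QuotientData.hatF_mem (qd : QuotientData D J) {x : B} (hx : qd.Q x = 0) (g : G) :
    hatF D x g ∈ J := by
  rw [← qd.q_ker, hatF, qd.q_E_s14, qd.Q_mul, hx, zero_mul, map_zero]

theorem QuotientData.Q_iota_of_mem (qd : QuotientData D J) {j : A} (hj : j ∈ J) :
    qd.Q (D.ι j) = 0 := by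
  have := qd.Q_gen j 1
  rwa [D.u_one, qd.Dq.u_one, mul_one, mul_one, (qd.q_ker j).2 hj, map_zero] at this

theorem QuotientData.genIdeal_subset_ker_s14 (qd : QuotientData D J) :
    genIdeal D J ⊆ {x : B | qd.Q x = 0} := by
  refine closure_minimal ?_ (isClosed_eq qd.Q_cont continuous_const)
  have h : Submodule.span ℂ {z : B | ∃ x y : B, ∃ j ∈ J, z = x * D.ι j * y} ≤
      LinearMap.ker qd.QCLM.toLinearMap := by
    refine Submodule.span_le.2 ?_
    rintro _ ⟨x, y, j, hj, rfl⟩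
    change qd.Q (x * D.ι j * y) = 0
    rw [qd.Q_mul, qd.Q_mul, qd.Q_iota_of_mem hj, mul_zero, zero_mul]
  exact fun z hz => h hz

end InducedIdeals

/-- Corollary `exact`. If there is a Fourier summing net for
`Σ` preserving the invariant ideals of `A`, then `Σ` is exact: `⟨J⟩ = J̃` for
every `α`-invariant closed two-sided ideal `J` of `A`. -/
theorem statement14 {A G B : Type*} [CStarAlgebra A] [Group G] [CStarAlgebra B]
    (S : TwistedSystem A G) (D : CrossedProduct S B)
    (hnet : ∃ net : FSNet D,
      ∀ J : Set A, IsInvIdeal S J → ∀ i g, ∀ a ∈ J, net.T i g a ∈ J) :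
    ∀ J : Set A, IsInvIdeal S J → ∀ qd : QuotientData D J,
      genIdeal D J = {x : B | qd.Q x = 0} := by
  obtain ⟨net, hpres⟩ := hnet
  intro J hJ qd
  refine qd.genIdeal_subset_ker_s14.antisymm fun x hx => ?_
  let := net.pre
  have := net.dir
  have := net.nonempty
  have hlim : Filter.Tendsto (fun i => net.M i x) Filter.atTop (nhds x) :=
    tendsto_iff_norm_sub_tendsto_zero.2 (net.M_lim x)
  refine isClosed_closure.mem_of_tendsto hlim (Filter.Eventually.of_forall fun i => ?_)
  refine (net.M_cf i x).mem_genIdeal fun g => ?_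
  have hT : IsMultiplier D (net.T i) (net.M i) := ⟨net.T_lin i, net.M_mult i⟩
  rw [hT.hatF_apply]
  exact hpres J hJ i g _ (qd.hatF_mem hx g)

end BCFourier
end
end

section
/- Assume A is commutative and let ω be a pure state of A. Let f ∈ C_c(Σ) take its values in the fixed-point algebra A^α = {a ∈ A : α_g(a) = a for all g ∈ G}. Then for every ξ ∈ A^G one has ‖ |Λ(f)ξ|_ω ‖₂ ≤ ‖ |f|_ω * |ξ|_ω ‖₂, where * denotes convolution on G and ‖·‖₂ the ℓ²(G)-norm. -/
open scoped ComplexOrder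

noncomputable section

namespace BCFourier

variable {A G B : Type*} [CStarAlgebra A] [Group G] [CStarAlgebra B]

variable {S : TwistedSystem A G}

/-- If `P = c* c` and `Q = d* d` are positive with `P + Q = r • 1` and `ω` is strictly
positive on both, then a pure state `ω` is multiplicative with respect to `P`. -/
lemma pureState_mul_of_add_eq {A : Type*} [CommCStarAlgebra A] (ω : A →L[ℂ] ℂ)
    (hω_pos : ∀ a : A, 0 ≤ ω (star a * a)) (hω_one : ω 1 = 1)
    (hω_pure : ∀ φ ψ : A →L[ℂ] ℂ, (∀ a : A, 0 ≤ φ (star a * a)) →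
      (∀ a : A, 0 ≤ ψ (star a * a)) → φ 1 = 1 → ψ 1 = 1 →
      ∀ t : ℝ, 0 < t → t < 1 →
        ω = (t : ℂ) • φ + ((1 - t : ℝ) : ℂ) • ψ → φ = ω)
    {c d : A} {r p q : ℝ} (hp : 0 < p) (hq : 0 < q)
    (hsum : star c * c + star d * d = (r : ℂ) • (1 : A))
    (hc : ω (star c * c) = p) (hd : ω (star d * d) = q) (x : A) :
    ω (star c * c * x) = ω (star c * c) * ω x := by
  have hr : p + q = r := by
    have h := congrArg ω hsum
    rw [map_add, hc, hd, map_smul, hω_one, smul_eq_mul, mul_one] at h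
    exact_mod_cast h
  have hr0 : 0 < r := by linarith
  have hpC : (p : ℂ) ≠ 0 := by exact_mod_cast hp.ne'
  have hqC : (q : ℂ) ≠ 0 := by exact_mod_cast hq.ne'
  have hrC : (r : ℂ) ≠ 0 := by exact_mod_cast hr0.ne'
  have key : ∀ (e : A) (s : ℝ), 0 < s → ∀ a : A,
      0 ≤ (((s : ℂ)⁻¹) • ω.comp (ContinuousLinearMap.mul ℂ A (star e * e))) (star a * a) := by
    intro e s hs a
    have h1 : star e * e * (star a * a) = star (e * a) * (e * a) := by
      rw [star_mul]; ring
    have h2 : (0 : ℂ) ≤ (s : ℂ)⁻¹ := by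
      rw [← Complex.ofReal_inv]
      exact_mod_cast (inv_pos.mpr hs).le
    simpa [h1] using mul_nonneg h2 (hω_pos (e * a))
  have h := hω_pure (((p : ℂ)⁻¹) • ω.comp (ContinuousLinearMap.mul ℂ A (star c * c)))
    (((q : ℂ)⁻¹) • ω.comp (ContinuousLinearMap.mul ℂ A (star d * d)))
    (key c p hp) (key d q hq) (by simp [hc, hpC]) (by simp [hd, hqC])
    (p / r) (div_pos hp hr0) ((div_lt_one hr0).mpr (by linarith)) (by
      ext y
      have hy : ω (star c * c * y) + ω (star d * d * y) = r * ω y := by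
        rw [← map_add, ← add_mul, hsum, smul_mul_assoc, one_mul, map_smul, smul_eq_mul]
      have hqr : ((1 - p / r : ℝ) : ℂ) = q / r := by
        rw [← Complex.ofReal_div]
        congr 1
        field_simp
        linarith
      simp only [add_apply, smul_apply,
        ContinuousLinearMap.comp_apply, ContinuousLinearMap.mul_apply', smul_eq_mul, hqr,
        Complex.ofReal_div]
      field_simp
      linear_combination -hy)
  have hx := congrArg (fun φ : A →L[ℂ] ℂ => φ x) h
  simp only [smul_apply, ContinuousLinearMap.comp_apply,
    ContinuousLinearMap.mul_apply', smul_eq_mul] at hx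
  rw [hc, ← hx]
  field_simp

/-- A self-adjoint element becomes positive after adding a scalar dominating its norm. -/
lemma exists_star_mul_self_eq_smul_one_add {A : Type*} [CStarAlgebra A] {b : A}
    (hb : IsSelfAdjoint b) {s : ℝ} (hs : ‖b‖ ≤ s) :
    ∃ c : A, star c * c = (s : ℂ) • (1 : A) + b := by
  let _ := CStarAlgebra.spectralOrder A
  have := CStarAlgebra.spectralOrderedRing A
  have h1 : -(algebraMap ℝ A ‖b‖) ≤ b := hb.neg_algebraMap_norm_le_self
  have h2 : algebraMap ℝ A ‖b‖ ≤ algebraMap ℝ A s := algebraMap_mono A hs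
  have h3 : (0 : A) ≤ algebraMap ℝ A s + b :=
    neg_le_iff_add_nonneg'.mp ((neg_le_neg h2).trans h1)
  obtain ⟨c, hc⟩ := CStarAlgebra.nonneg_iff_eq_star_mul_self.mp h3
  exact ⟨c, by rw [← hc, Algebra.algebraMap_eq_smul_one, Complex.coe_smul]⟩

/-- Pure states of commutative C*-algebras are multiplicative. -/
lemma pureState_map_mul {A : Type*} [CommCStarAlgebra A] (ω : A →L[ℂ] ℂ)
    (hω_pos : ∀ a : A, 0 ≤ ω (star a * a)) (hω_one : ω 1 = 1)
    (hω_pure : ∀ φ ψ : A →L[ℂ] ℂ, (∀ a : A, 0 ≤ φ (star a * a)) →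
      (∀ a : A, 0 ≤ ψ (star a * a)) → φ 1 = 1 → ψ 1 = 1 →
      ∀ t : ℝ, 0 < t → t < 1 →
        ω = (t : ℂ) • φ + ((1 - t : ℝ) : ℂ) • ψ → φ = ω)
    (a x : A) : ω (a * x) = ω a * ω x := by
  have hsa : ∀ b : A, IsSelfAdjoint b → ω (b * x) = ω b * ω x := by
    intro b hb
    set s : ℝ := ‖b‖ + 1
    have hs : ‖b‖ ≤ s := by simp [s]
    have hs0 : 0 < s := by positivity
    obtain ⟨e₁, he₁⟩ := exists_star_mul_self_eq_smul_one_add hb hs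
    obtain ⟨e₂, he₂⟩ := exists_star_mul_self_eq_smul_one_add hb.neg (by rwa [norm_neg] : ‖-b‖ ≤ s)
    obtain ⟨c, hc⟩ := exists_star_mul_self_eq_smul_one_add hb (by linarith : ‖b‖ ≤ 2 * s)
    obtain ⟨d, hd⟩ := exists_star_mul_self_eq_smul_one_add hb.neg
      (by rw [norm_neg]; linarith : ‖-b‖ ≤ 2 * s)
    have h1 := hω_pos e₁
    have h2 := hω_pos e₂
    rw [he₁, map_add, map_smul, hω_one, smul_eq_mul, mul_one, Complex.nonneg_iff] at h1
    rw [he₂, map_add, map_smul, hω_one, smul_eq_mul, mul_one, map_neg, Complex.nonneg_iff] at h2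
    simp only [Complex.add_re, Complex.add_im, Complex.ofReal_re, Complex.ofReal_im,
      Complex.neg_re] at h1 h2
    have hreal : ω b = ((ω b).re : ℂ) := by
      apply Complex.ext <;> simp
      linarith [h1.2]
    have hcω : ω (star c * c) = ((2 * s + (ω b).re : ℝ) : ℂ) := by
      rw [hc, map_add, map_smul, hω_one, smul_eq_mul, mul_one, Complex.ofReal_add, ← hreal]
    have hdω : ω (star d * d) = ((2 * s - (ω b).re : ℝ) : ℂ) := by
      rw [hd, map_add, map_smul, hω_one, smul_eq_mul, mul_one, Complex.ofReal_sub, map_neg,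
        ← hreal, sub_eq_add_neg]
    have h := pureState_mul_of_add_eq ω hω_pos hω_one hω_pure (r := 4 * s)
      (by linarith [h1.1, h2.1]) (by linarith [h1.1, h2.1])
      (by rw [hc, hd]; push_cast; module) hcω hdω x
    rw [hc, add_mul, smul_mul_assoc, one_mul, map_add, map_add, map_smul, map_smul, hω_one,
      smul_eq_mul, smul_eq_mul] at h
    linear_combination h
  rw [← realPart_add_I_smul_imaginaryPart a, add_mul, smul_mul_assoc, map_add, map_add,
    map_smul, map_smul, hsa _ (realPart a).2, hsa _ (imaginaryPart a).2, smul_eq_mul, smul_eq_mul]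
  ring

/-- Pure states of commutative C*-algebras are characters. -/
def pureStateAlgHom {A : Type*} [CommCStarAlgebra A] (ω : A →L[ℂ] ℂ) (hω_one : ω 1 = 1)
    (hmul : ∀ a x : A, ω (a * x) = ω a * ω x) : A →ₐ[ℂ] ℂ :=
  AlgHom.ofLinearMap ω.toLinearMap hω_one hmul

lemma map_star_mul_self_of_map_mul {A : Type*} [CommCStarAlgebra A] (ω : A →L[ℂ] ℂ)
    (hω_one : ω 1 = 1) (hmul : ∀ a x : A, ω (a * x) = ω a * ω x) (a : A) :
    ω (star a * a) = ((‖ω a‖ ^ 2 : ℝ) : ℂ) := by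
  have h : ω (star a) = star (ω a) :=
    haveI := AlgHomClass.instStarHomClass (F := A →ₐ[ℂ] ℂ) (A := A)
    map_star (pureStateAlgHom ω hω_one hmul) a
  rw [hmul, h, Complex.star_def, Complex.conj_mul']
  push_cast
  rfl

/-- Lemma `commineq`. For commutative `A`, a pure state `ω`
of `A`, and `f ∈ C_c(Σ)` with values in the fixed-point algebra `A^α`, one has
`‖|Λ(f)ξ|_ω‖₂ ≤ ‖|f|_ω ∗ |ξ|_ω‖₂` for all `ξ ∈ A^G`. -/
theorem statement18 {A G : Type*} [CommCStarAlgebra A] [Group G]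
    (S : TwistedSystem A G) (ω : A →L[ℂ] ℂ)
    -- `ω` is a state ...
    (hω_pos : ∀ a : A, 0 ≤ ω (star a * a)) (hω_one : ω 1 = 1)
    -- ... which is pure (an extreme point of the state space)
    (hω_pure : ∀ φ ψ : A →L[ℂ] ℂ, (∀ a : A, 0 ≤ φ (star a * a)) →
      (∀ a : A, 0 ≤ ψ (star a * a)) → φ 1 = 1 → ψ 1 = 1 →
      ∀ t : ℝ, 0 < t → t < 1 →
        ω = (t : ℂ) • φ + ((1 - t : ℝ) : ℂ) • ψ → φ = ω)
    (f : G → A) (hf_fin : (Function.support f).Finite)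
    (hf_fix : ∀ g h, S.α h (f g) = f g)
    (ξ : G → A) (hξ : Summable fun g => star (ξ g) * ξ g) :
    Summable (fun h : G =>
      Real.sqrt (ω (star (∑ᶠ g, (S.α h).symm (f g) *
          ((S.α h).symm (S.σ g (g⁻¹ * h)) * ξ (g⁻¹ * h))) *
        (∑ᶠ g, (S.α h).symm (f g) *
          ((S.α h).symm (S.σ g (g⁻¹ * h)) * ξ (g⁻¹ * h))))).re ^ 2) ∧
    Real.sqrt (∑' h : G,
        Real.sqrt (ω (star (∑ᶠ g, (S.α h).symm (f g) *
            ((S.α h).symm (S.σ g (g⁻¹ * h)) * ξ (g⁻¹ * h))) *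
          (∑ᶠ g, (S.α h).symm (f g) *
            ((S.α h).symm (S.σ g (g⁻¹ * h)) * ξ (g⁻¹ * h))))).re ^ 2) ≤
      Real.sqrt (∑' h : G,
        (∑ᶠ g, Real.sqrt (ω (star (f g) * f g)).re *
          Real.sqrt (ω (star (ξ (g⁻¹ * h)) * ξ (g⁻¹ * h))).re) ^ 2) := by
  have hmul := pureState_map_mul ω hω_pos hω_one hω_pure
  have hsq := map_star_mul_self_of_map_mul ω hω_one hmul
  have habs : ∀ a : A, Real.sqrt (ω (star a * a)).re = ‖ω a‖ := fun a => by
    rw [hsq, Complex.ofReal_re, Real.sqrt_sq (norm_nonneg _)]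
  simp only [habs]
  set s : Finset G := hf_fin.toFinset
  have hs : ∀ g, g ∉ s → f g = 0 := fun g hg => by
    simpa [s] using hg
  have hsymm : ∀ g h, (S.α h).symm (f g) = f g := fun g h => by
    rw [StarAlgEquiv.symm_apply_eq, hf_fix]
  have hnormσ : ∀ g h k, ‖ω ((S.α h).symm (S.σ g k))‖ = 1 := fun g h k => by
    have hu : star ((S.α h).symm (S.σ g k)) * (S.α h).symm (S.σ g k) = 1 := by
      rw [← map_star, ← map_mul, Unitary.star_mul_self_of_mem (S.σ_unitary g k), map_one]
    have h2 := hsq ((S.α h).symm (S.σ g k))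
    rw [hu, hω_one] at h2
    have h3 : ‖ω ((S.α h).symm (S.σ g k))‖ ^ 2 = 1 := by exact_mod_cast h2.symm
    exact (pow_eq_one_iff_of_nonneg (norm_nonneg _) two_ne_zero).mp h3
  have hR : ∀ h, ∑ᶠ g, ‖ω (f g)‖ * ‖ω (ξ (g⁻¹ * h))‖ =
      ∑ g ∈ s, ‖ω (f g)‖ * ‖ω (ξ (g⁻¹ * h))‖ := fun h =>
    finsum_eq_sum_of_support_subset _ fun g hg => by
      by_contra hgs
      exact hg (by simp [hs g hgs])
  have hL : ∀ h, ‖ω (∑ᶠ g, (S.α h).symm (f g) *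
      ((S.α h).symm (S.σ g (g⁻¹ * h)) * ξ (g⁻¹ * h)))‖ ≤
      ∑ g ∈ s, ‖ω (f g)‖ * ‖ω (ξ (g⁻¹ * h))‖ := fun h => by
    rw [finsum_eq_sum_of_support_subset (s := s) _ fun g hg => by
      by_contra hgs
      exact hg (by simp [hs g hgs]), map_sum]
    refine (norm_sum_le _ _).trans_eq (Finset.sum_congr rfl fun g _ => ?_)
    rw [hmul, hmul, norm_mul, norm_mul, hnormσ, one_mul, hsymm]
  have hξω : Summable fun g => ‖ω (ξ g)‖ ^ 2 := by
    have h := (ω.summable hξ).mapL Complex.reCLM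
    simpa only [hsq, Complex.reCLM_apply, Complex.ofReal_re] using h
  have hsumR : Summable fun h => (∑ g ∈ s, ‖ω (f g)‖ * ‖ω (ξ (g⁻¹ * h))‖) ^ 2 := by
    refine Summable.of_nonneg_of_le (fun _ => sq_nonneg _)
      (fun h => sq_sum_le_card_mul_sum_sq) (Summable.mul_left _ (summable_sum fun g _ => ?_))
    simp only [mul_pow]
    exact ((Equiv.mulLeft g⁻¹).summable_iff.mpr hξω).mul_left _
  have hle := fun h => pow_le_pow_left₀ (norm_nonneg _) (hL h) 2
  have hsumL := Summable.of_nonneg_of_le (fun _ => sq_nonneg _) hle hsumR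
  refine ⟨hsumL, Real.sqrt_le_sqrt ?_⟩
  simp only [hR]
  exact hsumL.tsum_le_tsum hle hsumR

end BCFourier
end
end
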